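/- arXiv:0705.0766 — 8 statements merged into one kernel-verified Lean document; each statement's English description precedes it below -/
import Mathlib

section
/- Let R be an algebraic curvature tensor on E with nonnegative isotropic curvature, and suppose the orthonormal four-frame {e_1,e_2,e_3,e_4} attains isotropic curvature zero. Then Σ_{p,q=1}^4 (R_{1p1q} + R_{2p2q})(R_{3p3q} + R_{4p4q}) - Σ_{p,q=1}^4 R_{12pq} R_{34pq} = Σ_{p,q=1}^4 (R_{1p3q} + R_{2p4q})(R_{3p1q} + R_{4p2q}) + Σ_{p,q=1}^4 (R_{1p4q} - R_{2p3q})(R_{4p1q} - R_{3p2q}). -/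
open scoped BigOperators
open RealInnerProductSpace

noncomputable section

abbrev Euc (n : ℕ) : Type := EuclideanSpace ℝ (Fin n)

/-- The space of quadrilinear (multilinear) maps `E → E → E → E → ℝ`. -/
abbrev CurvMap (n : ℕ) : Type := Euc n →ₗ[ℝ] Euc n →ₗ[ℝ] Euc n →ₗ[ℝ] Euc n →ₗ[ℝ] ℝ

/-- `R` is an algebraic curvature tensor: antisymmetric in the first two arguments,
symmetric under interchange of the first and second pair, and satisfying the
first Bianchi identity. -/
def IsCurvatureTensor {n : ℕ} (R : CurvMap n) : Prop :=
  (∀ x y z w : Euc n, R x y z w = - R y x z w) ∧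
  (∀ x y z w : Euc n, R x y z w = R z w x y) ∧
  (∀ x y z w : Euc n, R x y z w + R y z x w + R z x y w = 0)

/-- Nonnegative isotropic curvature for a quadrilinear form on `EuclideanSpace ℝ (Fin m)`. -/
def NonnegIsotropic {m : ℕ} (R : Euc m → Euc m → Euc m → Euc m → ℝ) : Prop :=
  ∀ v₁ v₂ v₃ v₄ : Euc m, Orthonormal ℝ ![v₁, v₂, v₃, v₄] →
    0 ≤ R v₁ v₃ v₁ v₃ + R v₁ v₄ v₁ v₄ + R v₂ v₃ v₂ v₃ + R v₂ v₄ v₂ v₄ - 2 * R v₁ v₂ v₃ v₄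

theorem eq_zero_of_forall_unit_circle {G H : ℝ}
    (h : ∀ c s : ℝ, c ^ 2 + s ^ 2 = 1 → 0 ≤ 2 * (c * s) * G + s ^ 2 * H) : G = 0 := by
  have key : ∀ x : ℝ, 0 ≤ 2 * x * G + x ^ 2 * H := by
    intro x
    have hpos : 0 < 1 + x ^ 2 := by positivity
    have hr : 0 < √(1 + x ^ 2) := Real.sqrt_pos.2 hpos
    have hsq : √(1 + x ^ 2) ^ 2 = 1 + x ^ 2 := Real.sq_sqrt hpos.le
    have h1 := h (1 / √(1 + x ^ 2)) (x / √(1 + x ^ 2)) (by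
      rw [div_pow, div_pow, hsq]; field_simp)
    have h2 : 2 * x * G + x ^ 2 * H = √(1 + x ^ 2) ^ 2 *
        (2 * (1 / √(1 + x ^ 2) * (x / √(1 + x ^ 2))) * G + (x / √(1 + x ^ 2)) ^ 2 * H) := by
      field_simp
    rw [h2]
    positivity
  have hK : 0 < |H| + 1 := by positivity
  have h1 := key (-G / (|H| + 1))
  have h2 : 2 * (-G / (|H| + 1)) * G + (-G / (|H| + 1)) ^ 2 * H =
      G ^ 2 * (H - 2 * (|H| + 1)) / (|H| + 1) ^ 2 := by
    field_simp
    ring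
  rw [h2, le_div_iff₀ (by positivity), zero_mul] at h1
  have h3 : G ^ 2 = 0 := by nlinarith [sq_nonneg G, le_abs_self H, abs_nonneg H]
  exact pow_eq_zero_iff two_ne_zero |>.1 h3

theorem orthonormal_vec_four_iff {n : ℕ} (v₁ v₂ v₃ v₄ : Euc n) :
    Orthonormal ℝ ![v₁, v₂, v₃, v₄] ↔
      (⟪v₁, v₁⟫ = 1 ∧ ⟪v₂, v₂⟫ = 1 ∧ ⟪v₃, v₃⟫ = 1 ∧ ⟪v₄, v₄⟫ = 1) ∧
      ⟪v₁, v₂⟫ = 0 ∧ ⟪v₁, v₃⟫ = 0 ∧ ⟪v₁, v₄⟫ = 0 ∧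
      ⟪v₂, v₃⟫ = 0 ∧ ⟪v₂, v₄⟫ = 0 ∧ ⟪v₃, v₄⟫ = 0 := by
  rw [orthonormal_iff_ite]
  simp only [Fin.forall_fin_succ, Fin.isValue]
  simp [real_inner_comm v₁ v₂, real_inner_comm v₁ v₃, real_inner_comm v₁ v₄,
    real_inner_comm v₂ v₃, real_inner_comm v₂ v₄, real_inner_comm v₃ v₄,
    Fin.ext_iff]
  tauto

theorem Orthonormal.rotate_first_fourth {n : ℕ} {v₁ v₂ v₃ v₄ : Euc n}
    (hv : Orthonormal ℝ ![v₁, v₂, v₃, v₄]) {c s : ℝ} (hcs : c ^ 2 + s ^ 2 = 1) :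
    Orthonormal ℝ ![c • v₁ + s • v₄, v₂, v₃, (-s) • v₁ + c • v₄] := by
  rw [orthonormal_vec_four_iff] at hv ⊢
  obtain ⟨⟨h11, h22, h33, h44⟩, h12, h13, h14, h23, h24, h34⟩ := hv
  have h41 := (real_inner_comm v₁ v₄).trans h14
  have h42 := (real_inner_comm v₂ v₄).trans h24
  have h43 := (real_inner_comm v₃ v₄).trans h34
  have h21 := (real_inner_comm v₁ v₂).trans h12
  have h31 := (real_inner_comm v₁ v₃).trans h13
  refine ⟨⟨?_, h22, h33, ?_⟩, ?_, ?_, ?_, h23, ?_, ?_⟩ <;>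
    simp only [inner_add_left, inner_add_right, real_inner_smul_left, real_inner_smul_right,
      h11, h44, h12, h13, h14, h24, h34, h41, h42, h43, h21, h31] <;>
    first | ring1 | linear_combination hcs

theorem Orthonormal.rotate_first_third {n : ℕ} {v₁ v₂ v₃ v₄ : Euc n}
    (hv : Orthonormal ℝ ![v₁, v₂, v₃, v₄]) {c s : ℝ} (hcs : c ^ 2 + s ^ 2 = 1) :
    Orthonormal ℝ ![c • v₁ + s • v₃, v₂, (-s) • v₁ + c • v₃, v₄] := by
  rw [orthonormal_vec_four_iff] at hv ⊢
  obtain ⟨⟨h11, h22, h33, h44⟩, h12, h13, h14, h23, h24, h34⟩ := hv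
  have h32 := (real_inner_comm v₂ v₃).trans h23
  have h21 := (real_inner_comm v₁ v₂).trans h12
  have h31 := (real_inner_comm v₁ v₃).trans h13
  refine ⟨⟨?_, h22, ?_, h44⟩, ?_, ?_, ?_, ?_, h24, ?_⟩ <;>
    simp only [inner_add_left, inner_add_right, real_inner_smul_left, real_inner_smul_right,
      h11, h33, h12, h13, h14, h23, h34, h21, h31, h32] <;>
    first | ring1 | linear_combination hcs

theorem IsCurvatureTensor.first_order_rotation_first_fourth {n : ℕ} {R : CurvMap n}
    (hR : IsCurvatureTensor R) (hnic : NonnegIsotropic (fun x y z w => R x y z w))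
    {e₁ e₂ e₃ e₄ : Euc n} (he : Orthonormal ℝ ![e₁, e₂, e₃, e₄])
    (h0 : R e₁ e₃ e₁ e₃ + R e₁ e₄ e₁ e₄ + R e₂ e₃ e₂ e₃ + R e₂ e₄ e₂ e₄
      - 2 * R e₁ e₂ e₃ e₄ = 0) :
    R e₁ e₃ e₄ e₃ - R e₂ e₁ e₂ e₄ - R e₄ e₂ e₃ e₄ + R e₁ e₂ e₃ e₁ = 0 := by
  refine eq_zero_of_forall_unit_circle (H := R e₃ e₄ e₃ e₄ + R e₁ e₄ e₁ e₄ + R e₂ e₃ e₂ e₃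
    + R e₁ e₂ e₁ e₂ + 2 * R e₄ e₂ e₃ e₁) fun c s hcs => ?_
  have h := hnic _ _ _ _ (he.rotate_first_fourth hcs)
  obtain ⟨h₁, h₂, -⟩ := hR
  have h₀ : ∀ x z w, R x x z w = 0 := fun x z w => by linarith [h₁ x x z w]
  have h₀' : ∀ x z w, R z w x x = 0 := fun x z w => by rw [h₂, h₀]
  have h₁' : ∀ x y z w, R x y z w = -R x y w z := fun x y z w => by rw [h₂, h₁, h₂ w]
  simp only [map_add, LinearMap.add_apply, map_smul, LinearMap.smul_apply, smul_eq_mul, h₀, h₀',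
    h₁ e₂ e₁, h₁' _ _ e₂ e₁, h₁' _ _ e₃ e₁, h₁ e₄ e₁, h₁' _ _ e₄ e₁, h₁ e₄ e₂, h₁ e₄ e₃,
    h₁' _ _ e₄ e₃, h₂ e₂ e₄ e₁ e₂, h₂ e₂ e₄ e₁ e₃, h₂ e₃ e₄ e₁ e₃] at h h0 ⊢
  linear_combination h + c ^ 2 * h0 + ((c ^ 2 + s ^ 2) * R e₁ e₄ e₁ e₄ - R e₂ e₃ e₂ e₃) * hcs

theorem IsCurvatureTensor.first_order_rotation_first_third {n : ℕ} {R : CurvMap n}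
    (hR : IsCurvatureTensor R) (hnic : NonnegIsotropic (fun x y z w => R x y z w))
    {e₁ e₂ e₃ e₄ : Euc n} (he : Orthonormal ℝ ![e₁, e₂, e₃, e₄])
    (h0 : R e₁ e₃ e₁ e₃ + R e₁ e₄ e₁ e₄ + R e₂ e₃ e₂ e₃ + R e₂ e₄ e₂ e₄
      - 2 * R e₁ e₂ e₃ e₄ = 0) :
    R e₁ e₄ e₃ e₄ - R e₂ e₁ e₂ e₃ - R e₃ e₂ e₃ e₄ + R e₁ e₂ e₁ e₄ = 0 := by
  refine eq_zero_of_forall_unit_circle (H := R e₃ e₄ e₃ e₄ + R e₁ e₃ e₁ e₃ + R e₂ e₄ e₂ e₄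
    + R e₁ e₂ e₁ e₂ + 2 * R e₃ e₂ e₁ e₄) fun c s hcs => ?_
  have h := hnic _ _ _ _ (he.rotate_first_third hcs)
  obtain ⟨h₁, h₂, -⟩ := hR
  have h₀ : ∀ x z w, R x x z w = 0 := fun x z w => by linarith [h₁ x x z w]
  have h₀' : ∀ x z w, R z w x x = 0 := fun x z w => by rw [h₂, h₀]
  have h₁' : ∀ x y z w, R x y z w = -R x y w z := fun x y z w => by rw [h₂, h₁, h₂ w]
  simp only [map_add, LinearMap.add_apply, map_smul, LinearMap.smul_apply, smul_eq_mul, h₀, h₀',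
    h₁ e₂ e₁, h₁' _ _ e₂ e₁, h₁ e₃ e₁, h₁' _ _ e₃ e₁, h₁ e₃ e₂, h₂ e₂ e₃ e₁ e₂, h₂ e₂ e₃ e₁ e₄,
    h₂ e₃ e₄ e₁ e₄] at h h0 ⊢
  linear_combination h + c ^ 2 * h0 + ((c ^ 2 + s ^ 2) * R e₁ e₃ e₁ e₃ - R e₂ e₄ e₂ e₄) * hcs

theorem curvature_sum_identity {T : Fin 4 → Fin 4 → Fin 4 → Fin 4 → ℝ}
    (h₁ : ∀ x y z w, T x y z w = -T y x z w) (h₂ : ∀ x y z w, T x y z w = T z w x y)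
    (h₃ : ∀ x y z w, T x y z w + T y z x w + T z x y w = 0)
    (h0 : T 0 2 0 2 + T 0 3 0 3 + T 1 2 1 2 + T 1 3 1 3 - 2 * T 0 1 2 3 = 0)
    (g1 : T 0 2 3 2 - T 1 0 1 3 - T 3 1 2 3 + T 0 1 2 0 = 0)
    (g2 : T 0 3 2 3 - T 1 0 1 2 - T 2 1 2 3 + T 0 1 0 3 = 0) :
    (∑ p, ∑ q, (T 0 p 0 q + T 1 p 1 q) * (T 2 p 2 q + T 3 p 3 q))
      - (∑ p, ∑ q, T 0 1 p q * T 2 3 p q)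
    = (∑ p, ∑ q, (T 0 p 2 q + T 1 p 3 q) * (T 2 p 0 q + T 3 p 1 q))
      + (∑ p, ∑ q, (T 0 p 3 q - T 1 p 2 q) * (T 3 p 0 q - T 2 p 1 q)) := by
  have h₀ : ∀ x z w, T x x z w = 0 := fun x z w => by linarith [h₁ x x z w]
  have h₀' : ∀ x z w, T z w x x = 0 := fun x z w => by rw [h₂, h₀]
  have h₁' : ∀ x y z w, T x y z w = -T x y w z := fun x y z w => by rw [h₂, h₁, h₂ w]
  have hb := h₃ 0 1 2 3
  simp only [Fin.sum_univ_four, h₀, h₀', h₁ 1 0, h₁' _ _ 1 0, h₁ 2 0, h₁' _ _ 2 0, h₁ 3 0,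
    h₁' _ _ 3 0, h₁ 2 1, h₁' _ _ 2 1, h₁ 3 1, h₁' _ _ 3 1, h₁ 3 2, h₁' _ _ 3 2, h₂ 0 2 0 1,
    h₂ 0 3 0 1, h₂ 1 2 0 1, h₂ 1 3 0 1, h₂ 2 3 0 1, h₂ 0 3 0 2, h₂ 1 2 0 2, h₂ 1 3 0 2,
    h₂ 2 3 0 2, h₂ 1 2 0 3, h₂ 1 3 0 3, h₂ 2 3 0 3, h₂ 1 3 1 2, h₂ 2 3 1 2,
    h₂ 2 3 1 3] at h0 g1 g2 hb ⊢
  have e0 : T 0 2 0 2 = 2 * T 0 1 2 3 - T 0 3 0 3 - T 1 2 1 2 - T 1 3 1 3 := by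
    linear_combination h0
  have e1 : T 0 1 1 3 = T 0 2 2 3 - T 1 3 2 3 + T 0 1 0 2 := by linear_combination g1
  have e2 : T 0 1 1 2 = -T 0 3 2 3 - T 1 2 2 3 - T 0 1 0 3 := by linear_combination g2
  have e3 : T 0 3 1 2 = T 0 2 1 3 - T 0 1 2 3 := by linear_combination hb
  rw [e0, e1, e2, e3]
  ring

/-- Proposition `p.and.q.between.1.and.4`: the identity for the sums over `p, q = 1, …, 4`,
at a frame where the isotropic curvature attains its minimum value zero. -/
theorem stmt_10 {n : ℕ} (hn : 4 ≤ n) (R : CurvMap n) (hR : IsCurvatureTensor R)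
    (b : OrthonormalBasis (Fin n) ℝ (Euc n))
    (hnic : NonnegIsotropic (fun x y z w => R x y z w)) :
    let e₁ : Euc n := b ⟨0, by omega⟩
    let e₂ : Euc n := b ⟨1, by omega⟩
    let e₃ : Euc n := b ⟨2, by omega⟩
    let e₄ : Euc n := b ⟨3, by omega⟩
    let c : Fin 4 → Fin n := Fin.castLE hn
    R e₁ e₃ e₁ e₃ + R e₁ e₄ e₁ e₄ + R e₂ e₃ e₂ e₃ + R e₂ e₄ e₂ e₄ - 2 * R e₁ e₂ e₃ e₄ = 0 →
    (∑ p : Fin 4, ∑ q : Fin 4,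
        (R e₁ (b (c p)) e₁ (b (c q)) + R e₂ (b (c p)) e₂ (b (c q))) *
          (R e₃ (b (c p)) e₃ (b (c q)) + R e₄ (b (c p)) e₄ (b (c q))))
      - (∑ p : Fin 4, ∑ q : Fin 4, R e₁ e₂ (b (c p)) (b (c q)) * R e₃ e₄ (b (c p)) (b (c q)))
    = (∑ p : Fin 4, ∑ q : Fin 4,
        (R e₁ (b (c p)) e₃ (b (c q)) + R e₂ (b (c p)) e₄ (b (c q))) *
          (R e₃ (b (c p)) e₁ (b (c q)) + R e₄ (b (c p)) e₂ (b (c q))))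
      + (∑ p : Fin 4, ∑ q : Fin 4,
        (R e₁ (b (c p)) e₄ (b (c q)) - R e₂ (b (c p)) e₃ (b (c q))) *
          (R e₄ (b (c p)) e₁ (b (c q)) - R e₃ (b (c p)) e₂ (b (c q)))) := by
  intro e₁ e₂ e₃ e₄ c h0
  have he : Orthonormal ℝ ![e₁, e₂, e₃, e₄] := by
    have hbc : ![e₁, e₂, e₃, e₄] = b ∘ c := by
      funext i
      fin_cases i <;> rfl
    rw [hbc]
    exact b.orthonormal.comp c (Fin.castLE_injective hn)
  exact curvature_sum_identity (T := fun i j k l => R (b (c i)) (b (c j)) (b (c k)) (b (c l)))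
    (fun i j k l => hR.1 _ _ _ _) (fun i j k l => hR.2.1 _ _ _ _)
    (fun i j k l => hR.2.2 _ _ _ _) h0 (hR.first_order_rotation_first_fourth hnic he h0)
    (hR.first_order_rotation_first_third hnic he h0)
end
end

section
/- Let R be an algebraic curvature tensor on E with nonnegative isotropic curvature, and suppose the orthonormal four-frame {e_1,e_2,e_3,e_4} attains isotropic curvature zero. Then for every index q with 5 ≤ q ≤ n, R_{133q} + R_{144q} + R_{432q} = 0 and R_{233q} + R_{244q} + R_{341q} = 0. -/
open scoped BigOperators
open RealInnerProductSpace

noncomputable section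

/-- First-order condition at `θ = 0` for a trigonometric polynomial of degree two that is
nonnegative on the unit circle and vanishes at `θ = 0`. -/
theorem eq_of_trig_nonneg {a k d m p r : ℝ}
    (h : ∀ c s : ℝ, c ^ 2 + s ^ 2 = 1 →
      0 ≤ c ^ 2 * a + 2 * (c * s) * k + s ^ 2 * d + m - 2 * (c * p + s * r))
    (h0 : a + m - 2 * p = 0) : k = r := by
  set f : ℝ → ℝ := fun θ => Real.cos θ ^ 2 * a + 2 * (Real.cos θ * Real.sin θ) * k
    + Real.sin θ ^ 2 * d + m - 2 * (Real.cos θ * p + Real.sin θ * r) with hf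
  have hmin : IsLocalMin f 0 := by
    refine Filter.Eventually.of_forall fun θ => ?_
    have := h _ _ (Real.cos_sq_add_sin_sq θ)
    simp only [hf, Real.cos_zero, Real.sin_zero]
    linarith
  have hc := Real.hasDerivAt_cos 0
  have hs := Real.hasDerivAt_sin 0
  have hd := (((((hc.pow 2).mul_const a).add (((hc.mul hs).const_mul 2).mul_const k)).add
    ((hs.pow 2).mul_const d)).add_const m).sub
    (((hc.mul_const p).add (hs.mul_const r)).const_mul 2)
  have := hmin.hasDerivAt_eq_zero hd
  simp at this
  linarith

/-- Rotating the first vector of an orthonormal frame in the plane it spans with an additional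
orthonormal vector preserves orthonormality. -/
theorem Orthonormal.rotate_first {E : Type*} [NormedAddCommGroup E] [InnerProductSpace ℝ E]
    {v₁ v₂ v₃ v₄ w : E} (h : Orthonormal ℝ ![v₁, v₂, v₃, v₄, w]) {c s : ℝ}
    (hcs : c ^ 2 + s ^ 2 = 1) : Orthonormal ℝ ![c • v₁ + s • w, v₂, v₃, v₄] := by
  rw [orthonormal_iff_ite] at h ⊢
  simp only [Fin.forall_fin_succ, Matrix.cons_val_zero, Matrix.cons_val_succ, inner_add_left,
    inner_add_right, real_inner_smul_left, real_inner_smul_right, Fin.succ_inj,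
    Fin.succ_ne_zero, (Fin.succ_ne_zero _).symm, IsEmpty.forall_iff, if_true, if_false,
    and_true] at h ⊢
  obtain ⟨⟨h00, h01, h02, h03, h04⟩, ⟨h10, h11, h12, h13, h14⟩, ⟨h20, h21, h22, h23, h24⟩,
    ⟨h30, h31, h32, h33, h34⟩, h40, h41, h42, h43, h44⟩ := h
  simp only [h00, h01, h02, h03, h04, h10, h11, h12, h13, h14, h20, h21, h22, h23, h24, h30, h31,
    h32, h33, h34, h40, h41, h42, h43, h44]
  refine ⟨⟨by linarith, ?_⟩, ?_⟩ <;> norm_num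

/-- First-order condition, in a direction `w` orthogonal to the frame, for moving the first vector
of a four-frame of vanishing isotropic curvature. -/
theorem NonnegIsotropic.first_order {n : ℕ} {R : CurvMap n} (hR : IsCurvatureTensor R)
    (hnic : NonnegIsotropic (fun x y z w => R x y z w)) {v₁ v₂ v₃ v₄ w : Euc n}
    (ho : Orthonormal ℝ ![v₁, v₂, v₃, v₄, w])
    (h0 : R v₁ v₃ v₁ v₃ + R v₁ v₄ v₁ v₄ + R v₂ v₃ v₂ v₃ + R v₂ v₄ v₂ v₄
      - 2 * R v₁ v₂ v₃ v₄ = 0) :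
    R v₁ v₃ v₃ w + R v₁ v₄ v₄ w + R v₄ v₃ v₂ w = 0 := by
  obtain ⟨anti, symm, -⟩ := hR
  have key : R v₁ v₃ w v₃ + R v₁ v₄ w v₄ = R w v₂ v₃ v₄ := by
    refine eq_of_trig_nonneg (a := R v₁ v₃ v₁ v₃ + R v₁ v₄ v₁ v₄)
      (d := R w v₃ w v₃ + R w v₄ w v₄) (m := R v₂ v₃ v₂ v₃ + R v₂ v₄ v₂ v₄)
      (p := R v₁ v₂ v₃ v₄) (fun c s hcs => ?_) (by linarith)
    have := hnic _ _ _ _ (ho.rotate_first hcs)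
    simp only [map_add, map_smul, LinearMap.add_apply, LinearMap.smul_apply, smul_eq_mul,
      symm w v₃ v₁ v₃, symm w v₄ v₁ v₄] at this
    linarith
  have h3 : R v₁ v₃ v₃ w = -R v₁ v₃ w v₃ := by rw [symm, anti, symm]
  have h4 : R v₁ v₄ v₄ w = -R v₁ v₄ w v₄ := by rw [symm, anti, symm]
  have h2 : R v₄ v₃ v₂ w = R w v₂ v₃ v₄ := by rw [anti, symm, anti, neg_neg]
  linarith

/-- Lemma `first.order.conditions.2`: first-order conditions in the directions `e_q`,
`5 ≤ q ≤ n`, at a minimizing four-frame. -/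
theorem stmt_11 {n : ℕ} (hn : 4 ≤ n) (R : CurvMap n) (hR : IsCurvatureTensor R)
    (b : OrthonormalBasis (Fin n) ℝ (Euc n))
    (hnic : NonnegIsotropic (fun x y z w => R x y z w)) :
    let e₁ : Euc n := b ⟨0, by omega⟩
    let e₂ : Euc n := b ⟨1, by omega⟩
    let e₃ : Euc n := b ⟨2, by omega⟩
    let e₄ : Euc n := b ⟨3, by omega⟩
    R e₁ e₃ e₁ e₃ + R e₁ e₄ e₁ e₄ + R e₂ e₃ e₂ e₃ + R e₂ e₄ e₂ e₄ - 2 * R e₁ e₂ e₃ e₄ = 0 →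
    ∀ q : Fin n, 4 ≤ (q : ℕ) →
      (R e₁ e₃ e₃ (b q) + R e₁ e₄ e₄ (b q) + R e₄ e₃ e₂ (b q) = 0 ∧
       R e₂ e₃ e₃ (b q) + R e₂ e₄ e₄ (b q) + R e₃ e₄ e₁ (b q) = 0) := by
  intro e₁ e₂ e₃ e₄ h0 q hq
  have ho : Orthonormal ℝ ![e₁, e₂, e₃, e₄, b q] := by
    have heq : ![e₁, e₂, e₃, e₄, b q] =
        b ∘ ![⟨0, by omega⟩, ⟨1, by omega⟩, ⟨2, by omega⟩, ⟨3, by omega⟩, q] := by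
      funext i
      fin_cases i <;> rfl
    rw [heq]
    refine b.orthonormal.comp _ fun i j hij => ?_
    fin_cases i <;> fin_cases j <;> simp [Fin.ext_iff] at hij ⊢ <;> omega
  have ho' : Orthonormal ℝ ![e₂, e₁, e₄, e₃, b q] := by
    have heq : ![e₂, e₁, e₄, e₃, b q] = ![e₁, e₂, e₃, e₄, b q] ∘ ![1, 0, 3, 2, 4] := by
      funext i
      fin_cases i <;> rfl
    rw [heq]
    exact ho.comp _ (by decide)
  refine ⟨hnic.first_order hR ho h0, ?_⟩
  have h12 : R e₂ e₁ e₄ e₃ = R e₁ e₂ e₃ e₄ := by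
    rw [hR.1, hR.2.1, hR.1, hR.2.1, neg_neg]
  have := hnic.first_order hR ho' (by linarith)
  linarith
end
end

section
/- Let R be an algebraic curvature tensor on E with nonnegative isotropic curvature, and suppose the orthonormal four-frame {e_1,e_2,e_3,e_4} attains isotropic curvature zero. Then for each fixed index q with 5 ≤ q ≤ n, Σ_{p=1}^4 (R_{1p1q} + R_{2p2q})(R_{3p3q} + R_{4p4q}) - Σ_{p=1}^4 R_{12pq} R_{34pq} = Σ_{p=1}^4 (R_{1p3q} + R_{2p4q})(R_{3p1q} + R_{4p2q}) + Σ_{p=1}^4 (R_{1p4q} - R_{2p3q})(R_{4p1q} - R_{3p2q}). -/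
open scoped BigOperators
open RealInnerProductSpace

noncomputable section

theorem orthonormal_vecCons_four {m : ℕ} {x y z w : Euc m}
    (hx : inner ℝ x x = 1) (hy : inner ℝ y y = 1) (hz : inner ℝ z z = 1) (hw : inner ℝ w w = 1)
    (hxy : inner ℝ x y = 0) (hxz : inner ℝ x z = 0) (hxw : inner ℝ x w = 0)
    (hyz : inner ℝ y z = 0) (hyw : inner ℝ y w = 0) (hzw : inner ℝ z w = 0) :
    Orthonormal ℝ ![x, y, z, w] := by
  rw [orthonormal_iff_ite]
  intro i j
  fin_cases i <;> fin_cases j <;>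
    simp [-inner_self_eq_norm_sq_to_K,
      hx, hy, hz, hw, hxy, hxz, hxw, hyz, hyw, hzw,
      real_inner_comm x y, real_inner_comm x z, real_inner_comm x w,
      real_inner_comm y z, real_inner_comm y w, real_inner_comm z w]

/-- First-order condition at a four-frame with vanishing isotropic curvature, obtained by rotating
the first frame vector `x` towards a unit vector `u` orthogonal to the frame. -/
theorem NonnegIsotropic.first_variation {m : ℕ} {R : CurvMap m} (hR : IsCurvatureTensor R)
    (hnic : NonnegIsotropic (fun x y z w => R x y z w)) {x y z w u : Euc m}
    (hx : inner ℝ x x = 1) (hy : inner ℝ y y = 1) (hz : inner ℝ z z = 1) (hw : inner ℝ w w = 1)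
    (hu : inner ℝ u u = 1)
    (hxy : inner ℝ x y = 0) (hxz : inner ℝ x z = 0) (hxw : inner ℝ x w = 0)
    (hyz : inner ℝ y z = 0) (hyw : inner ℝ y w = 0) (hzw : inner ℝ z w = 0)
    (hxu : inner ℝ x u = 0) (hyu : inner ℝ y u = 0) (hzu : inner ℝ z u = 0)
    (hwu : inner ℝ w u = 0)
    (h0 : R x z x z + R x w x w + R y z y z + R y w y w - 2 * R x y z w = 0) :
    R x z z u + R x w w u - R z w y u = 0 := by
  obtain ⟨anti, symm, -⟩ := hR
  have key : ∀ t : ℝ, 0 ≤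
      Real.cos t ^ 2 * (R x z x z + R x w x w)
        - 2 * (Real.cos t * Real.sin t) * (R x z z u + R x w w u)
        + Real.sin t ^ 2 * (R u z u z + R u w u w) + (R y z y z + R y w y w)
        - 2 * (Real.cos t * R x y z w - Real.sin t * R z w y u) := by
    intro t
    have hcs := Real.cos_sq_add_sin_sq t
    have h := hnic (Real.cos t • x + Real.sin t • u) y z w
      (orthonormal_vecCons_four
        (by
          simp only [inner_add_left, inner_add_right, real_inner_smul_left,
            real_inner_smul_right, hx, hu, hxu, real_inner_comm x u]
          linear_combination hcs)
        hy hz hw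
        (by simp [inner_add_left, real_inner_smul_left, hxy, real_inner_comm y u, hyu])
        (by simp [inner_add_left, real_inner_smul_left, hxz, real_inner_comm z u, hzu])
        (by simp [inner_add_left, real_inner_smul_left, hxw, real_inner_comm w u, hwu])
        hyz hyw hzw)
    simp only [map_add, map_smul, LinearMap.add_apply, LinearMap.smul_apply, smul_eq_mul] at h
    have swap : ∀ a c d e : Euc m, R a c d e = - R a c e d := fun a c d e => by
      rw [symm a c d e, anti d e a c, symm e d a c]
    rw [symm u z x z, symm u w x w, swap x z u z, swap x w u w, symm u y z w,
      swap z w u y] at h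
    linarith
  have hd := ((((((Real.hasDerivAt_cos 0).pow 2).mul_const (R x z x z + R x w x w)).sub
    ((((Real.hasDerivAt_cos 0).mul (Real.hasDerivAt_sin 0)).const_mul 2).mul_const
      (R x z z u + R x w w u))).add
    (((Real.hasDerivAt_sin 0).pow 2).mul_const (R u z u z + R u w u w))).add_const
      (R y z y z + R y w y w)).sub
    ((((Real.hasDerivAt_cos 0).mul_const (R x y z w)).sub
      ((Real.hasDerivAt_sin 0).mul_const (R z w y u))).const_mul 2)
  have hmin := IsLocalMin.hasDerivAt_eq_zero (Filter.Eventually.of_forall fun t => by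
    have := key t
    simp
    linarith) hd
  simp at hmin
  linarith

/-- The quadratic identity for the form `T x y z = R x y z u`, as a consequence of its symmetries
and of the four first-order conditions at the frame `e`. -/
theorem quadratic_identity_of_first_variation {V : Type*} (T : V → V → V → ℝ)
    (anti : ∀ x y z, T x y z = - T y x z)
    (bianchi : ∀ x y z, T x y z + T y z x + T z x y = 0) (e : Fin 4 → V)
    (h₁ : T (e 0) (e 2) (e 2) + T (e 0) (e 3) (e 3) - T (e 2) (e 3) (e 1) = 0)
    (h₂ : T (e 1) (e 2) (e 2) + T (e 1) (e 3) (e 3) + T (e 2) (e 3) (e 0) = 0)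
    (h₃ : T (e 2) (e 0) (e 0) + T (e 2) (e 1) (e 1) - T (e 0) (e 1) (e 3) = 0)
    (h₄ : T (e 3) (e 0) (e 0) + T (e 3) (e 1) (e 1) + T (e 0) (e 1) (e 2) = 0) :
    (∑ p, (T (e 0) (e p) (e 0) + T (e 1) (e p) (e 1)) *
        (T (e 2) (e p) (e 2) + T (e 3) (e p) (e 3)))
      - (∑ p, T (e 0) (e 1) (e p) * T (e 2) (e 3) (e p))
    = (∑ p, (T (e 0) (e p) (e 2) + T (e 1) (e p) (e 3)) *
        (T (e 2) (e p) (e 0) + T (e 3) (e p) (e 1)))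
      + (∑ p, (T (e 0) (e p) (e 3) - T (e 1) (e p) (e 2)) *
        (T (e 3) (e p) (e 0) - T (e 2) (e p) (e 1))) := by
  have self : ∀ x z, T x x z = 0 := fun x z => by linarith [anti x x z]
  simp only [Fin.sum_univ_four, self]
  have b₀ := bianchi (e 1) (e 2) (e 3)
  have b₁ := bianchi (e 0) (e 2) (e 3)
  have b₂ := bianchi (e 0) (e 1) (e 3)
  have b₃ := bianchi (e 0) (e 1) (e 2)
  simp only [anti (e 1) (e 0), anti (e 2) (e 0), anti (e 3) (e 0), anti (e 2) (e 1),
    anti (e 3) (e 1), anti (e 3) (e 2)] at *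
  grind

/-- Proposition `p.between.1.and.4.q.bigger.than.4`: the identity for the sum over
`p = 1, …, 4` at a fixed index `q` with `5 ≤ q ≤ n`, at a minimizing four-frame. -/
theorem stmt_12 {n : ℕ} (hn : 4 ≤ n) (R : CurvMap n) (hR : IsCurvatureTensor R)
    (b : OrthonormalBasis (Fin n) ℝ (Euc n))
    (hnic : NonnegIsotropic (fun x y z w => R x y z w)) :
    let e₁ : Euc n := b ⟨0, by omega⟩
    let e₂ : Euc n := b ⟨1, by omega⟩
    let e₃ : Euc n := b ⟨2, by omega⟩
    let e₄ : Euc n := b ⟨3, by omega⟩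
    let c : Fin 4 → Fin n := Fin.castLE hn
    R e₁ e₃ e₁ e₃ + R e₁ e₄ e₁ e₄ + R e₂ e₃ e₂ e₃ + R e₂ e₄ e₂ e₄ - 2 * R e₁ e₂ e₃ e₄ = 0 →
    ∀ q : Fin n, 4 ≤ (q : ℕ) →
    (∑ p : Fin 4,
        (R e₁ (b (c p)) e₁ (b q) + R e₂ (b (c p)) e₂ (b q)) *
          (R e₃ (b (c p)) e₃ (b q) + R e₄ (b (c p)) e₄ (b q)))
      - (∑ p : Fin 4, R e₁ e₂ (b (c p)) (b q) * R e₃ e₄ (b (c p)) (b q))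
    = (∑ p : Fin 4,
        (R e₁ (b (c p)) e₃ (b q) + R e₂ (b (c p)) e₄ (b q)) *
          (R e₃ (b (c p)) e₁ (b q) + R e₄ (b (c p)) e₂ (b q)))
      + (∑ p : Fin 4,
        (R e₁ (b (c p)) e₄ (b q) - R e₂ (b (c p)) e₃ (b q)) *
          (R e₄ (b (c p)) e₁ (b q) - R e₃ (b (c p)) e₂ (b q))) := by
  intro e₁ e₂ e₃ e₄ c h0 q hq
  have unit : ∀ i, inner ℝ (b i) (b i) = (1 : ℝ) := fun i => by
    rw [b.inner_eq_ite, if_pos rfl]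
  have orth : ∀ i j : Fin n, (i : ℕ) ≠ j → inner ℝ (b i) (b j) = (0 : ℝ) := fun i j hij => by
    rw [b.inner_eq_ite, if_neg (fun h => hij (congrArg Fin.val h))]
  obtain ⟨anti, symm, bianchi⟩ := id hR
  have h12 : inner ℝ e₁ e₂ = (0 : ℝ) := orth _ _ (by simp)
  have h13 : inner ℝ e₁ e₃ = (0 : ℝ) := orth _ _ (by simp)
  have h14 : inner ℝ e₁ e₄ = (0 : ℝ) := orth _ _ (by simp)
  have h23 : inner ℝ e₂ e₃ = (0 : ℝ) := orth _ _ (by simp)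
  have h24 : inner ℝ e₂ e₄ = (0 : ℝ) := orth _ _ (by simp)
  have h34 : inner ℝ e₃ e₄ = (0 : ℝ) := orth _ _ (by simp)
  have h1q : inner ℝ e₁ (b q) = (0 : ℝ) := orth _ _ (by simp; omega)
  have h2q : inner ℝ e₂ (b q) = (0 : ℝ) := orth _ _ (by simp; omega)
  have h3q : inner ℝ e₃ (b q) = (0 : ℝ) := orth _ _ (by simp; omega)
  have h4q : inner ℝ e₄ (b q) = (0 : ℝ) := orth _ _ (by simp; omega)
  have swap : ∀ x y : Euc n, R x y x y = R y x y x := fun x y => by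
    rw [anti x y x y, symm y x x y, anti x y y x, neg_neg]
  have neg₃ : ∀ x y z w : Euc n, R x y (-z) w = - R x y z w := fun x y z w => by
    rw [(R x y).map_neg]; rfl
  have neg₁ : ∀ x y z w : Euc n, R (-x) y z w = - R x y z w := fun x y z w => by
    rw [symm, neg₃, symm z w x y]
  have neg₂ : ∀ x y z w : Euc n, R x (-y) z w = - R x y z w := fun x y z w => by
    rw [anti, neg₁, anti x y]
  have u1 : inner ℝ e₁ e₁ = (1 : ℝ) := unit _
  have u2 : inner ℝ e₂ e₂ = (1 : ℝ) := unit _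
  have u3 : inner ℝ e₃ e₃ = (1 : ℝ) := unit _
  have u4 : inner ℝ e₄ e₄ = (1 : ℝ) := unit _
  have h21 := (real_inner_comm e₁ e₂).trans h12
  have h31 := (real_inner_comm e₁ e₃).trans h13
  have h41 := (real_inner_comm e₁ e₄).trans h14
  have h32 := (real_inner_comm e₂ e₃).trans h23
  have h42 := (real_inner_comm e₂ e₄).trans h24
  have h43 := (real_inner_comm e₃ e₄).trans h34
  have k₁ := hnic.first_variation hR u1 u2 u3 u4 (unit q) h12 h13 h14 h23 h24 h34
    h1q h2q h3q h4q h0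
  have k₃ := hnic.first_variation hR u3 u4 u1 u2 (unit q) h34 h31 h32 h41 h42 h12
    h3q h4q h1q h2q (by
      rw [symm e₃ e₄, swap e₃ e₁, swap e₃ e₂, swap e₄ e₁, swap e₄ e₂]; linarith)
  have k₂ := hnic.first_variation hR (x := e₂) (y := -e₁) (z := e₃) (w := e₄) (u := b q)
    u2 (by rw [inner_neg_neg, u1]) u3 u4 (unit q) (by rw [inner_neg_right, h21, neg_zero]) h23 h24
    (by rw [inner_neg_left, h13, neg_zero]) (by rw [inner_neg_left, h14, neg_zero]) h34
    h2q (by rw [inner_neg_left, h1q, neg_zero]) h3q h4q (by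
      simp only [neg₁, neg₂, neg₃, neg_neg]
      rw [anti e₂ e₁]; linarith)
  have k₄ := hnic.first_variation hR (x := e₄) (y := -e₃) (z := e₁) (w := e₂) (u := b q)
    u4 (by rw [inner_neg_neg, u3]) u1 u2 (unit q) (by rw [inner_neg_right, h43, neg_zero]) h41 h42
    (by rw [inner_neg_left, h31, neg_zero]) (by rw [inner_neg_left, h32, neg_zero]) h12
    h4q (by rw [inner_neg_left, h3q, neg_zero]) h1q h2q (by
      simp only [neg₁, neg₂, neg₃, neg_neg]
      rw [anti e₄ e₃, symm e₃ e₄, swap e₃ e₁, swap e₃ e₂, swap e₄ e₁, swap e₄ e₂]; linarith)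
  simp only [neg₃, sub_neg_eq_add] at k₂ k₄
  exact quadratic_identity_of_first_variation (fun x y z => R x y z (b q))
    (fun x y z => anti x y z (b q)) (fun x y z => bianchi x y z (b q)) (fun p => b (c p))
    k₁ k₂ k₃ k₄
end
end

section
/- Let R be an algebraic curvature tensor on E with nonnegative isotropic curvature, and suppose the orthonormal four-frame {e_1,e_2,e_3,e_4} attains isotropic curvature zero. Then for all vectors w1, w2, w3, w4 ∈ E orthogonal to each of e_1, e_2, e_3, e_4, the expression R(w1,e3,w1,e3) + R(w1,e4,w1,e4) + R(w2,e3,w2,e3) + R(w2,e4,w2,e4) + R(e1,w3,e1,w3) + R(e2,w3,e2,w3) + R(e1,w4,e1,w4) + R(e2,w4,e2,w4) - 2[R(e3,w1,e1,w3) + R(e4,w1,e2,w3)] - 2[R(e4,w1,e1,w4) - R(e3,w1,e2,w4)] + 2[R(e4,w2,e1,w3) - R(e3,w2,e2,w3)] - 2[R(e3,w2,e1,w4) + R(e4,w2,e2,w4)] - 2 R(w1,w2,e3,e4) - 2 R(e1,e2,w3,w4) is nonnegative. -/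
open scoped BigOperators
open RealInnerProductSpace

noncomputable section

open TensorProduct

/-- The bilinear form on `E ⊗ E` induced by a quadrilinear map on `E`. -/
def bivectorForm {n : ℕ} (R : CurvMap n) :
    (Euc n ⊗[ℝ] Euc n) →ₗ[ℝ] (Euc n ⊗[ℝ] Euc n) →ₗ[ℝ] ℝ :=
  TensorProduct.lift (R.compr₂ (TensorProduct.uncurry (.id ℝ) (Euc n) (Euc n) ℝ))

@[simp]
lemma bivectorForm_tmul {n : ℕ} (R : CurvMap n) (x y z w : Euc n) :
    bivectorForm R (x ⊗ₜ y) (z ⊗ₜ w) = R x y z w := by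
  simp [bivectorForm]

lemma bivectorForm_symm {n : ℕ} {R : CurvMap n} (hR : IsCurvatureTensor R)
    (X Y : Euc n ⊗[ℝ] Euc n) : bivectorForm R X Y = bivectorForm R Y X := by
  have h : bivectorForm R = (bivectorForm R).flip :=
    TensorProduct.ext' fun x y => TensorProduct.ext' fun z w => by simpa using hR.2.1 x y z w
  exact LinearMap.congr_fun₂ h X Y

/-- The real part of `(x₁ + i x₂) ⊗ (y₁ + i y₂)`. -/
def reTensor {n : ℕ} (x₁ x₂ y₁ y₂ : Euc n) : Euc n ⊗[ℝ] Euc n :=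
  x₁ ⊗ₜ y₁ - x₂ ⊗ₜ y₂

/-- The imaginary part of `(x₁ + i x₂) ⊗ (y₁ + i y₂)`. -/
def imTensor {n : ℕ} (x₁ x₂ y₁ y₂ : Euc n) : Euc n ⊗[ℝ] Euc n :=
  x₁ ⊗ₜ y₂ + x₂ ⊗ₜ y₁

/-- The Hermitian extension of the curvature form evaluated on `X + i Y`. -/
def hermitianForm {n : ℕ} (R : CurvMap n) (X Y : Euc n ⊗[ℝ] Euc n) : ℝ :=
  bivectorForm R X X + bivectorForm R Y Y

/-- The Hermitian curvature form evaluated on `(x₁ + i x₂) ∧ (y₁ + i y₂)`. -/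
def isotropicForm {n : ℕ} (R : CurvMap n) (x₁ x₂ y₁ y₂ : Euc n) : ℝ :=
  hermitianForm R (reTensor x₁ x₂ y₁ y₂) (imTensor x₁ x₂ y₁ y₂)

lemma isotropicForm_eq {n : ℕ} {R : CurvMap n} (hR : IsCurvatureTensor R)
    (x₁ x₂ y₁ y₂ : Euc n) :
    isotropicForm R x₁ x₂ y₁ y₂ = R x₁ y₁ x₁ y₁ + R x₁ y₂ x₁ y₂ + R x₂ y₁ x₂ y₁
      + R x₂ y₂ x₂ y₂ - 2 * R x₁ x₂ y₁ y₂ := by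
  obtain ⟨ha, hs, hb⟩ := hR
  simp only [isotropicForm, hermitianForm, reTensor, imTensor, map_add, map_sub,
    LinearMap.add_apply, LinearMap.sub_apply, bivectorForm_tmul]
  linarith [hs x₂ y₂ x₁ y₁, hs x₂ y₁ x₁ y₂, hb x₁ x₂ y₁ y₂, ha x₂ y₁ x₁ y₂, ha x₁ y₁ x₂ y₂]

lemma isotropicForm_smul {n : ℕ} (R : CurvMap n) (a c : ℝ) (x₁ x₂ y₁ y₂ : Euc n) :
    isotropicForm R (a • x₁) (a • x₂) (c • y₁) (c • y₂) =
      (a * c) ^ 2 * isotropicForm R x₁ x₂ y₁ y₂ := by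
  simp only [isotropicForm, hermitianForm, reTensor, imTensor, map_add, map_sub,
    LinearMap.add_apply, LinearMap.sub_apply, bivectorForm_tmul, map_smul,
    LinearMap.smul_apply, smul_eq_mul]
  ring

/-- Subtracting a complex multiple of the first vector from the second does not change the form. -/
lemma isotropicForm_shear {n : ℕ} {R : CurvMap n} (hR : IsCurvatureTensor R) (p q : ℝ)
    (x₁ x₂ y₁ y₂ : Euc n) :
    isotropicForm R x₁ x₂ (y₁ - p • x₁ - q • x₂) (y₂ + q • x₁ - p • x₂) =
      isotropicForm R x₁ x₂ y₁ y₂ := by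
  have ha : ∀ x y (Z : Euc n ⊗[ℝ] Euc n),
      bivectorForm R (x ⊗ₜ y) Z = -bivectorForm R (y ⊗ₜ x) Z := fun x y Z => by
    induction Z with
    | zero => simp
    | tmul z w => simpa using hR.1 x y z w
    | add Z W hZ hW => rw [map_add, map_add, hZ, hW]; ring
  have h0 : ∀ x (Z : Euc n ⊗[ℝ] Euc n), bivectorForm R (x ⊗ₜ x) Z = 0 := fun x Z => by
    linarith [ha x x Z]
  have hX : bivectorForm R (reTensor x₁ x₂ (y₁ - p • x₁ - q • x₂) (y₂ + q • x₁ - p • x₂)) =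
      bivectorForm R (reTensor x₁ x₂ y₁ y₂) := by
    refine LinearMap.ext fun Z => ?_
    simp [reTensor, tmul_add, tmul_sub, h0]
    linear_combination (-q) * ha x₁ x₂ Z
  have hY : bivectorForm R (imTensor x₁ x₂ (y₁ - p • x₁ - q • x₂) (y₂ + q • x₁ - p • x₂)) =
      bivectorForm R (imTensor x₁ x₂ y₁ y₂) := by
    refine LinearMap.ext fun Z => ?_
    simp [imTensor, tmul_add, tmul_sub, h0]
    linear_combination (-p) * ha x₁ x₂ Z
  unfold isotropicForm hermitianForm
  rw [hX, hY, bivectorForm_symm hR _ (reTensor x₁ x₂ (_ - _) _),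
    bivectorForm_symm hR _ (imTensor x₁ x₂ (_ - _) _), hX, hY]

lemma isotropicForm_nonneg_of_orthogonal {n : ℕ} {R : CurvMap n} (hR : IsCurvatureTensor R)
    (hnic : NonnegIsotropic (fun x y z w => R x y z w)) {x₁ x₂ y₁ y₂ : Euc n}
    (hx : ‖x₁‖ = ‖x₂‖) (hy : ‖y₁‖ = ‖y₂‖) (hx₁₂ : ⟪x₁, x₂⟫ = 0) (hy₁₂ : ⟪y₁, y₂⟫ = 0)
    (h₁₁ : ⟪x₁, y₁⟫ = 0) (h₁₂ : ⟪x₁, y₂⟫ = 0) (h₂₁ : ⟪x₂, y₁⟫ = 0) (h₂₂ : ⟪x₂, y₂⟫ = 0) :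
    0 ≤ isotropicForm R x₁ x₂ y₁ y₂ := by
  by_cases hx0 : ‖x₁‖ = 0
  · have h1 : x₁ = 0 := norm_eq_zero.mp hx0
    have h2 : x₂ = 0 := norm_eq_zero.mp (hx ▸ hx0)
    simp [h1, h2, isotropicForm, hermitianForm, reTensor, imTensor]
  by_cases hy0 : ‖y₁‖ = 0
  · have h1 : y₁ = 0 := norm_eq_zero.mp hy0
    have h2 : y₂ = 0 := norm_eq_zero.mp (hy ▸ hy0)
    simp [h1, h2, isotropicForm, hermitianForm, reTensor, imTensor]
  have hx0' : ‖x₂‖ ≠ 0 := hx ▸ hx0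
  have hy0' : ‖y₂‖ ≠ 0 := hy ▸ hy0
  have ho : Orthonormal ℝ ![‖x₁‖⁻¹ • x₁, ‖x₁‖⁻¹ • x₂, ‖y₁‖⁻¹ • y₁, ‖y₁‖⁻¹ • y₂] := by
    refine ⟨fun i => ?_, fun i j hij => ?_⟩
    · fin_cases i <;> simp [norm_smul, hx, hy, hx0', hy0']
    · fin_cases i <;> fin_cases j <;>
        first
        | exact absurd rfl hij
        | simp [inner_smul_left, inner_smul_right, hx₁₂, hy₁₂, h₁₁, h₁₂, h₂₁, h₂₂,
            real_inner_comm x₁ x₂, real_inner_comm y₁ y₂, real_inner_comm x₁ y₁,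
            real_inner_comm x₁ y₂, real_inner_comm x₂ y₁, real_inner_comm x₂ y₂]
  have h := hnic _ _ _ _ ho
  have h' : 0 ≤ (‖x₁‖⁻¹ * ‖y₁‖⁻¹) ^ 2 * isotropicForm R x₁ x₂ y₁ y₂ := by
    rw [← isotropicForm_smul, isotropicForm_eq hR]
    linarith [h]
  exact nonneg_of_mul_nonneg_right h' (by positivity)

/-- The isotropic form is nonnegative on every totally isotropic pair `x₁ + i x₂`, `y₁ + i y₂`. -/
lemma isotropicForm_nonneg {n : ℕ} {R : CurvMap n} (hR : IsCurvatureTensor R)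
    (hnic : NonnegIsotropic (fun x y z w => R x y z w)) {x₁ x₂ y₁ y₂ : Euc n}
    (hx : ⟪x₁, x₁⟫ = ⟪x₂, x₂⟫) (hy : ⟪y₁, y₁⟫ = ⟪y₂, y₂⟫) (hx₁₂ : ⟪x₁, x₂⟫ = 0)
    (hy₁₂ : ⟪y₁, y₂⟫ = 0) (hre : ⟪x₁, y₁⟫ = ⟪x₂, y₂⟫) (him : ⟪x₁, y₂⟫ = -⟪x₂, y₁⟫) :
    0 ≤ isotropicForm R x₁ x₂ y₁ y₂ := by
  have norm_eq : ∀ {x y : Euc n}, ⟪x, x⟫ = ⟪y, y⟫ → ‖x‖ = ‖y‖ := fun {x y} h => by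
    rw [norm_eq_sqrt_real_inner, norm_eq_sqrt_real_inner, h]
  by_cases hx0 : ⟪x₁, x₁⟫ = 0
  · have h1 : x₁ = 0 := inner_self_eq_zero.mp hx0
    have h2 : x₂ = 0 := inner_self_eq_zero.mp (hx ▸ hx0)
    simp [h1, h2, isotropicForm, hermitianForm, reTensor, imTensor]
  obtain ⟨p, hp⟩ : ∃ p, ⟪x₁, y₁⟫ = p * ⟪x₁, x₁⟫ := ⟨_, (div_mul_cancel₀ _ hx0).symm⟩
  obtain ⟨q, hq⟩ : ∃ q, ⟪x₂, y₁⟫ = q * ⟪x₁, x₁⟫ := ⟨_, (div_mul_cancel₀ _ hx0).symm⟩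
  have hx₂₁ : ⟪x₂, x₁⟫ = 0 := by rw [real_inner_comm, hx₁₂]
  rw [← isotropicForm_shear hR p q]
  refine isotropicForm_nonneg_of_orthogonal hR hnic (norm_eq hx) (norm_eq ?_) hx₁₂ ?_ ?_ ?_ ?_ ?_
  all_goals
    simp only [inner_add_left, inner_sub_left, inner_add_right, inner_sub_right,
      real_inner_smul_left, real_inner_smul_right, real_inner_comm x₁ y₁, real_inner_comm x₂ y₁,
      real_inner_comm x₁ y₂, real_inner_comm x₂ y₂, hx₁₂, hx₂₁, hy₁₂, him, ← hre, ← hx, hp, hq, hy]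
    ring

/-- A nonnegative real polynomial of degree at most eight vanishing at the origin has nonnegative
quadratic coefficient. -/
lemma quadratic_coeff_nonneg {a₁ a₂ a₃ a₄ a₅ a₆ a₇ a₈ : ℝ}
    (h : ∀ s : ℝ, 0 ≤ a₁ * s + a₂ * s ^ 2 + a₃ * s ^ 3 + a₄ * s ^ 4 + a₅ * s ^ 5 + a₆ * s ^ 6
      + a₇ * s ^ 7 + a₈ * s ^ 8) : 0 ≤ a₂ := by
  have hc : Continuous fun s : ℝ => a₂ + a₄ * s ^ 2 + a₆ * s ^ 4 + a₈ * s ^ 6 := by fun_prop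
  have ht : Filter.Tendsto (fun s : ℝ => a₂ + a₄ * s ^ 2 + a₆ * s ^ 4 + a₈ * s ^ 6)
      (nhdsWithin 0 {0}ᶜ) (nhds a₂) := by
    simpa using (hc.tendsto 0).mono_left nhdsWithin_le_nhds
  refine ge_of_tendsto ht ?_
  filter_upwards [self_mem_nhdsWithin] with s hs
  refine nonneg_of_mul_nonneg_right (a := s ^ 2) ?_ (by have : s ≠ 0 := hs; positivity)
  linarith [h s, h (-s)]

lemma hermitianForm_curve {n : ℕ} {R : CurvMap n} (hR : IsCurvatureTensor R)
    {X₀ X₁ X₂ X₃ X₄ Y₀ Y₁ Y₂ Y₃ Y₄ : Euc n ⊗[ℝ] Euc n} (h0 : hermitianForm R X₀ Y₀ = 0)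
    (h : ∀ s : ℝ, 0 ≤ hermitianForm R
      (X₀ + s • X₁ + s ^ 2 • X₂ + s ^ 3 • X₃ + s ^ 4 • X₄)
      (Y₀ + s • Y₁ + s ^ 2 • Y₂ + s ^ 3 • Y₃ + s ^ 4 • Y₄)) :
    0 ≤ hermitianForm R X₁ Y₁ + 2 * (bivectorForm R X₀ X₂ + bivectorForm R Y₀ Y₂) := by
  let β := bivectorForm R
  have e : ∀ (A₀ A₁ A₂ A₃ A₄ : Euc n ⊗[ℝ] Euc n) (s : ℝ),
      β (A₀ + s • A₁ + s ^ 2 • A₂ + s ^ 3 • A₃ + s ^ 4 • A₄)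
        (A₀ + s • A₁ + s ^ 2 • A₂ + s ^ 3 • A₃ + s ^ 4 • A₄) =
      β A₀ A₀ + 2 * β A₀ A₁ * s + (β A₁ A₁ + 2 * β A₀ A₂) * s ^ 2
        + 2 * (β A₀ A₃ + β A₁ A₂) * s ^ 3 + (β A₂ A₂ + 2 * β A₀ A₄ + 2 * β A₁ A₃) * s ^ 4
        + 2 * (β A₁ A₄ + β A₂ A₃) * s ^ 5 + (β A₃ A₃ + 2 * β A₂ A₄) * s ^ 6
        + 2 * β A₃ A₄ * s ^ 7 + β A₄ A₄ * s ^ 8 := fun A₀ A₁ A₂ A₃ A₄ s => by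
    simp only [map_add, map_smul, LinearMap.add_apply, LinearMap.smul_apply, smul_eq_mul, β,
      bivectorForm_symm hR A₁ A₀, bivectorForm_symm hR A₂ A₀, bivectorForm_symm hR A₃ A₀,
      bivectorForm_symm hR A₄ A₀, bivectorForm_symm hR A₂ A₁, bivectorForm_symm hR A₃ A₁,
      bivectorForm_symm hR A₄ A₁, bivectorForm_symm hR A₃ A₂, bivectorForm_symm hR A₄ A₂,
      bivectorForm_symm hR A₄ A₃]
    ring
  refine quadratic_coeff_nonneg
    (a₁ := 2 * β X₀ X₁ + 2 * β Y₀ Y₁)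
    (a₃ := 2 * (β X₀ X₃ + β X₁ X₂) + 2 * (β Y₀ Y₃ + β Y₁ Y₂))
    (a₄ := β X₂ X₂ + 2 * β X₀ X₄ + 2 * β X₁ X₃ + (β Y₂ Y₂ + 2 * β Y₀ Y₄ + 2 * β Y₁ Y₃))
    (a₅ := 2 * (β X₁ X₄ + β X₂ X₃) + 2 * (β Y₁ Y₄ + β Y₂ Y₃))
    (a₆ := β X₃ X₃ + 2 * β X₂ X₄ + (β Y₃ Y₃ + 2 * β Y₂ Y₄))
    (a₇ := 2 * β X₃ X₄ + 2 * β Y₃ Y₄) (a₈ := β X₄ X₄ + β Y₄ Y₄) fun s => ?_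
  have h0' : β X₀ X₀ + β Y₀ Y₀ = 0 := h0
  have hs := (h s).trans_eq (congrArg₂ (· + ·) (e X₀ X₁ X₂ X₃ X₄ s) (e Y₀ Y₁ Y₂ Y₃ Y₄ s))
  refine hs.trans_eq ?_
  simp only [hermitianForm]
  linear_combination h0'

/-- The second-order term making `e + s w` isotropic, where `e` and `w` list the real and imaginary
parts of two complex vectors each. -/
def isotropicCorrection {n : ℕ} (e w : Fin 4 → Euc n) : Fin 4 → Euc n :=
  let c := ⟪w 0, w 0⟫ - ⟪w 1, w 1⟫
  let c' := 2 * ⟪w 0, w 1⟫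
  let d := ⟪w 0, w 2⟫ - ⟪w 1, w 3⟫
  let d' := ⟪w 0, w 3⟫ + ⟪w 1, w 2⟫
  let g := ⟪w 2, w 2⟫ - ⟪w 3, w 3⟫
  let g' := 2 * ⟪w 2, w 3⟫
  ![(-(1 / 4) : ℝ) • (c • e 0 + c' • e 1 + d • e 2 + d' • e 3),
    (-(1 / 4) : ℝ) • (c' • e 0 - c • e 1 + d' • e 2 - d • e 3),
    (-(1 / 4) : ℝ) • (d • e 0 + d' • e 1 + g • e 2 + g' • e 3),
    (-(1 / 4) : ℝ) • (d' • e 0 - d • e 1 + g' • e 2 - g • e 3)]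

/-- Multiplication by `i` of two complex vectors listed by real and imaginary parts. -/
def mulI {n : ℕ} (w : Fin 4 → Euc n) : Fin 4 → Euc n :=
  ![-w 1, w 0, -w 3, w 2]

lemma isotropicCorrection_mulI {n : ℕ} (e w : Fin 4 → Euc n) :
    isotropicCorrection e (mulI w) = -isotropicCorrection e w := by
  funext i
  fin_cases i <;>
    simp [isotropicCorrection, mulI, real_inner_comm (w 0) (w 1),
      real_inner_comm (w 2) (w 3)] <;>
    module

lemma isotropicForm_curve_nonneg {n : ℕ} {R : CurvMap n} (hR : IsCurvatureTensor R)
    (hnic : NonnegIsotropic (fun x y z w => R x y z w)) {e w : Fin 4 → Euc n}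
    (he : Orthonormal ℝ e) (hw : ∀ i j, ⟪w i, e j⟫ = 0) (s : ℝ) :
    let v : Fin 4 → Euc n := fun i => e i + s • w i + s ^ 2 • isotropicCorrection e w i
    0 ≤ isotropicForm R (v 0) (v 1) (v 2) (v 3) := by
  have hee : ∀ i j, ⟪e i, e j⟫ = if i = j then (1 : ℝ) else 0 := orthonormal_iff_ite.mp he
  have hw' : ∀ i j, ⟪e i, w j⟫ = 0 := fun i j => by rw [real_inner_comm, hw]
  intro v
  have hwa : ∀ i j, ⟪w i, isotropicCorrection e w j⟫ = 0 := fun i j => by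
    fin_cases j <;> simp [isotropicCorrection, inner_add_right, inner_sub_right,
      real_inner_smul_right, hw]
  have haw : ∀ i j, ⟪isotropicCorrection e w i, w j⟫ = 0 := fun i j => by
    rw [real_inner_comm, hwa]
  have hv : ∀ i j, ⟪v i, v j⟫ = (if i = j then 1 else 0) + s ^ 2 * (⟪w i, w j⟫
      + ⟪e i, isotropicCorrection e w j⟫ + ⟪e j, isotropicCorrection e w i⟫)
      + s ^ 4 * ⟪isotropicCorrection e w i, isotropicCorrection e w j⟫ := fun i j => by
    simp only [v, inner_add_left, inner_add_right, real_inner_smul_left, real_inner_smul_right,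
      hee, hw, hw', hwa, haw, real_inner_comm (e j) (isotropicCorrection e w i)]
    ring
  refine isotropicForm_nonneg hR hnic ?_ ?_ ?_ ?_ ?_ ?_
  all_goals
    rw [hv]
    try rw [hv]
    simp only [isotropicCorrection, Matrix.cons_val, inner_add_left, inner_add_right,
      inner_sub_left, inner_sub_right, real_inner_smul_left, real_inner_smul_right, hee,
      Fin.isValue, Fin.reduceEq, if_true, if_false]
    ring

/-- The second variation inequality at a frame with vanishing isotropic curvature. -/
lemma isotropic_second_variation {n : ℕ} {R : CurvMap n} (hR : IsCurvatureTensor R)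
    (hnic : NonnegIsotropic (fun x y z w => R x y z w)) {e w : Fin 4 → Euc n}
    (he : Orthonormal ℝ e) (hw : ∀ i j, ⟪w i, e j⟫ = 0)
    (h0 : isotropicForm R (e 0) (e 1) (e 2) (e 3) = 0) :
    let a := isotropicCorrection e w
    0 ≤ hermitianForm R
        (reTensor (w 0) (w 1) (e 2) (e 3) + reTensor (e 0) (e 1) (w 2) (w 3))
        (imTensor (w 0) (w 1) (e 2) (e 3) + imTensor (e 0) (e 1) (w 2) (w 3))
      + 2 * (bivectorForm R (reTensor (e 0) (e 1) (e 2) (e 3))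
          (reTensor (w 0) (w 1) (w 2) (w 3) + reTensor (a 0) (a 1) (e 2) (e 3)
            + reTensor (e 0) (e 1) (a 2) (a 3))
        + bivectorForm R (imTensor (e 0) (e 1) (e 2) (e 3))
          (imTensor (w 0) (w 1) (w 2) (w 3) + imTensor (a 0) (a 1) (e 2) (e 3)
            + imTensor (e 0) (e 1) (a 2) (a 3))) := by
  intro a
  refine hermitianForm_curve hR h0
    (X₃ := reTensor (w 0) (w 1) (a 2) (a 3) + reTensor (a 0) (a 1) (w 2) (w 3))
    (Y₃ := imTensor (w 0) (w 1) (a 2) (a 3) + imTensor (a 0) (a 1) (w 2) (w 3))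
    (X₄ := reTensor (a 0) (a 1) (a 2) (a 3)) (Y₄ := imTensor (a 0) (a 1) (a 2) (a 3)) fun s => ?_
  refine (isotropicForm_curve_nonneg hR hnic he hw s).trans_eq ?_
  unfold isotropicForm
  congr 1
  · simp only [reTensor, add_tmul, tmul_add, ← smul_tmul', tmul_smul, a]
    module
  · simp only [imTensor, add_tmul, tmul_add, ← smul_tmul', tmul_smul, a]
    module

lemma isotropic_hermitian_variation_nonneg {n : ℕ} {R : CurvMap n} (hR : IsCurvatureTensor R)
    (hnic : NonnegIsotropic (fun x y z w => R x y z w)) {e w : Fin 4 → Euc n}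
    (he : Orthonormal ℝ e) (hw : ∀ i j, ⟪w i, e j⟫ = 0)
    (h0 : isotropicForm R (e 0) (e 1) (e 2) (e 3) = 0) :
    0 ≤ hermitianForm R
      (reTensor (w 0) (w 1) (e 2) (e 3) + reTensor (e 0) (e 1) (w 2) (w 3))
      (imTensor (w 0) (w 1) (e 2) (e 3) + imTensor (e 0) (e 1) (w 2) (w 3)) := by
  have hw' : ∀ i j, ⟪mulI w i, e j⟫ = 0 := fun i j => by
    fin_cases i <;> simp [mulI, hw]
  have h1 := isotropic_second_variation hR hnic he hw h0
  have h2 := isotropic_second_variation hR hnic he hw' h0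
  rw [isotropicCorrection_mulI] at h2
  set a := isotropicCorrection e w
  have hX₁ : reTensor (mulI w 0) (mulI w 1) (e 2) (e 3)
        + reTensor (e 0) (e 1) (mulI w 2) (mulI w 3) =
      -(imTensor (w 0) (w 1) (e 2) (e 3) + imTensor (e 0) (e 1) (w 2) (w 3)) := by
    simp [reTensor, imTensor, mulI, neg_tmul, tmul_neg]
    abel
  have hY₁ : imTensor (mulI w 0) (mulI w 1) (e 2) (e 3)
        + imTensor (e 0) (e 1) (mulI w 2) (mulI w 3) =
      reTensor (w 0) (w 1) (e 2) (e 3) + reTensor (e 0) (e 1) (w 2) (w 3) := by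
    simp [reTensor, imTensor, mulI, neg_tmul, tmul_neg]
    abel
  have hX₂ : reTensor (mulI w 0) (mulI w 1) (mulI w 2) (mulI w 3)
        + reTensor ((-a) 0) ((-a) 1) (e 2) (e 3) + reTensor (e 0) (e 1) ((-a) 2) ((-a) 3) =
      -(reTensor (w 0) (w 1) (w 2) (w 3) + reTensor (a 0) (a 1) (e 2) (e 3)
        + reTensor (e 0) (e 1) (a 2) (a 3)) := by
    simp [reTensor, mulI, neg_tmul, tmul_neg]
    abel
  have hY₂ : imTensor (mulI w 0) (mulI w 1) (mulI w 2) (mulI w 3)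
        + imTensor ((-a) 0) ((-a) 1) (e 2) (e 3) + imTensor (e 0) (e 1) ((-a) 2) ((-a) 3) =
      -(imTensor (w 0) (w 1) (w 2) (w 3) + imTensor (a 0) (a 1) (e 2) (e 3)
        + imTensor (e 0) (e 1) (a 2) (a 3)) := by
    simp [imTensor, mulI, neg_tmul, tmul_neg]
    abel
  simp only [hX₁, hY₁, hX₂, hY₂] at h2
  simp only [hermitianForm, map_neg, LinearMap.neg_apply] at h1 h2 ⊢
  linarith

/-- Proposition `min` (second variation): for `w₁,…,w₄` orthogonal to the minimizing frame
`{e₁,e₂,e₃,e₄}`, the second-variation expression is nonnegative. -/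
theorem stmt_13 {n : ℕ} (hn : 4 ≤ n) (R : CurvMap n) (hR : IsCurvatureTensor R)
    (b : OrthonormalBasis (Fin n) ℝ (Euc n))
    (hnic : NonnegIsotropic (fun x y z w => R x y z w)) :
    let e₁ : Euc n := b ⟨0, by omega⟩
    let e₂ : Euc n := b ⟨1, by omega⟩
    let e₃ : Euc n := b ⟨2, by omega⟩
    let e₄ : Euc n := b ⟨3, by omega⟩
    R e₁ e₃ e₁ e₃ + R e₁ e₄ e₁ e₄ + R e₂ e₃ e₂ e₃ + R e₂ e₄ e₂ e₄ - 2 * R e₁ e₂ e₃ e₄ = 0 →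
    ∀ w₁ w₂ w₃ w₄ : Euc n,
      (∀ j : Fin 4, ⟪w₁, b (Fin.castLE hn j)⟫ = 0 ∧ ⟪w₂, b (Fin.castLE hn j)⟫ = 0 ∧
        ⟪w₃, b (Fin.castLE hn j)⟫ = 0 ∧ ⟪w₄, b (Fin.castLE hn j)⟫ = 0) →
      0 ≤ R w₁ e₃ w₁ e₃ + R w₁ e₄ w₁ e₄
          + R w₂ e₃ w₂ e₃ + R w₂ e₄ w₂ e₄
          + R e₁ w₃ e₁ w₃ + R e₂ w₃ e₂ w₃
          + R e₁ w₄ e₁ w₄ + R e₂ w₄ e₂ w₄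
          - 2 * (R e₃ w₁ e₁ w₃ + R e₄ w₁ e₂ w₃)
          - 2 * (R e₄ w₁ e₁ w₄ - R e₃ w₁ e₂ w₄)
          + 2 * (R e₄ w₂ e₁ w₃ - R e₃ w₂ e₂ w₃)
          - 2 * (R e₃ w₂ e₁ w₄ + R e₄ w₂ e₂ w₄)
          - 2 * R w₁ w₂ e₃ e₄ - 2 * R e₁ e₂ w₃ w₄ := by
  intro e₁ e₂ e₃ e₄ h0 w₁ w₂ w₃ w₄ hw
  have he : Orthonormal ℝ fun j : Fin 4 => b (Fin.castLE hn j) :=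
    b.orthonormal.comp _ (Fin.castLE_injective hn)
  have hw' : ∀ i j, ⟪![w₁, w₂, w₃, w₄] i, b (Fin.castLE hn j)⟫ = 0 := fun i j => by
    obtain ⟨h1, h2, h3, h4⟩ := hw j
    fin_cases i <;> assumption
  have h := isotropic_hermitian_variation_nonneg hR hnic he hw' ((isotropicForm_eq hR ..).trans h0)
  change 0 ≤ hermitianForm R (reTensor w₁ w₂ e₃ e₄ + reTensor e₁ e₂ w₃ w₄)
    (imTensor w₁ w₂ e₃ e₄ + imTensor e₁ e₂ w₃ w₄) at h
  have e : hermitianForm R (reTensor w₁ w₂ e₃ e₄ + reTensor e₁ e₂ w₃ w₄)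
      (imTensor w₁ w₂ e₃ e₄ + imTensor e₁ e₂ w₃ w₄) =
      isotropicForm R w₁ w₂ e₃ e₄ + isotropicForm R e₁ e₂ w₃ w₄
      + 2 * bivectorForm R (reTensor w₁ w₂ e₃ e₄) (reTensor e₁ e₂ w₃ w₄)
      + 2 * bivectorForm R (imTensor w₁ w₂ e₃ e₄) (imTensor e₁ e₂ w₃ w₄) := by
    simp only [isotropicForm, hermitianForm, map_add, LinearMap.add_apply,
      bivectorForm_symm hR (reTensor e₁ e₂ w₃ w₄), bivectorForm_symm hR (imTensor e₁ e₂ w₃ w₄)]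
    ring
  rw [e, isotropicForm_eq hR, isotropicForm_eq hR] at h
  simp only [reTensor, imTensor, map_add, map_sub, LinearMap.add_apply, LinearMap.sub_apply,
    bivectorForm_tmul] at h
  have ha := hR.1
  linarith [ha w₁ e₃ e₁ w₃, ha w₁ e₄ e₂ w₃, ha w₁ e₄ e₁ w₄, ha w₁ e₃ e₂ w₄, ha w₂ e₄ e₁ w₃,
    ha w₂ e₃ e₂ w₃, ha w₂ e₃ e₁ w₄, ha w₂ e₄ e₂ w₄]
end
end

section
/- Let φ, ψ ∈ Λ²ℝ⁴ be two-vectors satisfying φ ∧ φ = ψ ∧ ψ, φ ∧ ψ = 0, and ⟨φ,ψ⟩ = 0. Then there exists an orthonormal basis {e1,e2,e3,e4} of ℝ⁴ and real numbers a1, a2, b1, b2 with a1·a2 = b1·b2 such that φ = a1 e1∧e3 + a2 e4∧e2 and ψ = b1 e1∧e4 + b2 e2∧e3. -/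
open Matrix

theorem exists_smul_dotProduct_self_eq_one {n : Type*} [Fintype n] {y : n → ℝ} (hy : y ≠ 0) :
    ∃ u : n → ℝ, u ⬝ᵥ u = 1 ∧ ∃ c : ℝ, c ≠ 0 ∧ y = c • u := by
  have hpos : 0 < y ⬝ᵥ y :=
    lt_of_le_of_ne (Finset.sum_nonneg fun i _ => mul_self_nonneg (y i))
      fun h => hy (dotProduct_self_eq_zero.1 h.symm)
  have hs : √(y ⬝ᵥ y) ≠ 0 := (Real.sqrt_pos.2 hpos).ne'
  refine ⟨(√(y ⬝ᵥ y))⁻¹ • y, ?_, √(y ⬝ᵥ y), hs, by rw [smul_inv_smul₀ hs]⟩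
  rw [smul_dotProduct, dotProduct_smul, smul_eq_mul, smul_eq_mul, ← mul_assoc, ← mul_inv,
    Real.mul_self_sqrt hpos.le, inv_mul_cancel₀ hpos.ne']

theorem exists_unit_dotProduct_eq_zero (r : Fin 3 → ℝ) :
    ∃ w : Fin 3 → ℝ, w ⬝ᵥ w = 1 ∧ w ⬝ᵥ r = 0 := by
  obtain ⟨w, hw, hwr⟩ : ∃ w : Fin 3 → ℝ, w ≠ 0 ∧ w ⬝ᵥ r = 0 := by
    by_cases h : r 0 = 0
    · exact ⟨![1, 0, 0], fun h0 => by simpa using congrFun h0 0,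
        by simp [dotProduct, Fin.sum_univ_three, h]⟩
    · exact ⟨![-r 1, r 0, 0], fun h0 => h (by simpa using congrFun h0 1),
        by simp [dotProduct, Fin.sum_univ_three]; ring⟩
  obtain ⟨u, hu, c, hc, rfl⟩ := exists_smul_dotProduct_self_eq_one hw
  refine ⟨u, hu, ?_⟩
  simpa [smul_dotProduct, hc] using hwr

theorem exists_orthonormal_pair_smul {p r : Fin 3 → ℝ} (h : p ⬝ᵥ r = 0) :
    ∃ u v : Fin 3 → ℝ, u ⬝ᵥ u = 1 ∧ v ⬝ᵥ v = 1 ∧ u ⬝ᵥ v = 0 ∧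
      ∃ α β : ℝ, p = α • u ∧ r = β • v := by
  by_cases hp : p = 0
  · obtain ⟨v, hv, β, hβ⟩ : ∃ v : Fin 3 → ℝ, v ⬝ᵥ v = 1 ∧ ∃ β : ℝ, r = β • v := by
      by_cases hr : r = 0
      · obtain ⟨v, hv, -⟩ := exists_unit_dotProduct_eq_zero 0
        exact ⟨v, hv, 0, by simp [hr]⟩
      · obtain ⟨v, hv, β, -, hβ⟩ := exists_smul_dotProduct_self_eq_one hr
        exact ⟨v, hv, β, hβ⟩
    obtain ⟨u, hu, huv⟩ := exists_unit_dotProduct_eq_zero v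
    exact ⟨u, v, hu, hv, huv, 0, β, by simp [hp], hβ⟩
  · obtain ⟨u, hu, α, hα, rfl⟩ := exists_smul_dotProduct_self_eq_one hp
    have hur : u ⬝ᵥ r = 0 := by simpa [smul_dotProduct, hα] using h
    by_cases hr : r = 0
    · obtain ⟨v, hv, hvu⟩ := exists_unit_dotProduct_eq_zero u
      exact ⟨u, v, hu, hv, by rw [dotProduct_comm, hvu], α, 0, rfl, by simp [hr]⟩
    · obtain ⟨v, hv, β, hβ, rfl⟩ := exists_smul_dotProduct_self_eq_one hr
      exact ⟨u, v, hu, hv, by simpa [dotProduct_smul, hβ] using hur, α, β, rfl, rfl⟩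

/-- The self-dual two-vector of `ℝ⁴` with coordinates `p`. -/
def selfDual (p : Fin 3 → ℝ) : Matrix (Fin 4) (Fin 4) ℝ :=
  !![0, p 0, p 1, p 2; -p 0, 0, p 2, -p 1; -p 1, -p 2, 0, p 0; -p 2, p 1, -p 0, 0]

/-- The anti-self-dual two-vector of `ℝ⁴` with coordinates `q`. -/
def antiSelfDual (q : Fin 3 → ℝ) : Matrix (Fin 4) (Fin 4) ℝ :=
  !![0, q 0, q 1, q 2; -q 0, 0, -q 2, q 1; -q 1, q 2, 0, -q 0; -q 2, -q 1, q 0, 0]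

theorem selfDual_smul (c : ℝ) (p : Fin 3 → ℝ) : selfDual (c • p) = c • selfDual p := by
  ext i j; fin_cases i <;> fin_cases j <;> simp [selfDual]

theorem antiSelfDual_smul (c : ℝ) (q : Fin 3 → ℝ) :
    antiSelfDual (c • q) = c • antiSelfDual q := by
  ext i j; fin_cases i <;> fin_cases j <;> simp [antiSelfDual]

theorem transpose_selfDual (p : Fin 3 → ℝ) : (selfDual p)ᵀ = -selfDual p := by
  ext i j; fin_cases i <;> fin_cases j <;> simp [selfDual]

theorem selfDual_mul_add_mul (p r : Fin 3 → ℝ) :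
    selfDual p * selfDual r + selfDual r * selfDual p = (-2 * p ⬝ᵥ r) • 1 := by
  ext i j
  fin_cases i <;> fin_cases j <;>
    simp [selfDual, Fin.sum_univ_succ, dotProduct] <;> ring

theorem antiSelfDual_mul_add_mul (q s : Fin 3 → ℝ) :
    antiSelfDual q * antiSelfDual s + antiSelfDual s * antiSelfDual q = (-2 * q ⬝ᵥ s) • 1 := by
  ext i j
  fin_cases i <;> fin_cases j <;>
    simp [antiSelfDual, Fin.sum_univ_succ, dotProduct] <;> ring

theorem commute_selfDual_antiSelfDual (p q : Fin 3 → ℝ) :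
    Commute (selfDual p) (antiSelfDual q) := by
  ext i j
  fin_cases i <;> fin_cases j <;>
    simp [selfDual, antiSelfDual, Matrix.mul_apply, Fin.sum_univ_succ] <;> ring

theorem trace_selfDual_mul_antiSelfDual (p q : Fin 3 → ℝ) :
    (selfDual p * antiSelfDual q).trace = 0 := by
  simp [selfDual, antiSelfDual, Matrix.trace, Fin.sum_univ_succ]
  ring

theorem trace_selfDual_mul_mul_antiSelfDual_mul (p r q s : Fin 3 → ℝ) :
    (selfDual p * selfDual r * (antiSelfDual q * antiSelfDual s)).trace
      = 4 * (p ⬝ᵥ r) * (q ⬝ᵥ s) := by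
  simp [selfDual, antiSelfDual, Matrix.trace, Fin.sum_univ_succ, dotProduct]
  ring

theorem selfDual_mul_self {p : Fin 3 → ℝ} (hp : p ⬝ᵥ p = 1) :
    selfDual p * selfDual p = -1 := by
  have h := selfDual_mul_add_mul p p
  rw [hp, ← two_smul ℝ, mul_one, neg_smul, ← smul_neg] at h
  exact smul_right_injective _ (two_ne_zero' ℝ) h

theorem antiSelfDual_mul_self {q : Fin 3 → ℝ} (hq : q ⬝ᵥ q = 1) :
    antiSelfDual q * antiSelfDual q = -1 := by
  have h := antiSelfDual_mul_add_mul q q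
  rw [hq, ← two_smul ℝ, mul_one, neg_smul, ← smul_neg] at h
  exact smul_right_injective _ (two_ne_zero' ℝ) h

theorem selfDual_mul_comm_neg {p r : Fin 3 → ℝ} (h : p ⬝ᵥ r = 0) :
    selfDual r * selfDual p = -(selfDual p * selfDual r) := by
  have h' := selfDual_mul_add_mul p r
  rw [h, mul_zero, zero_smul] at h'
  exact eq_neg_of_add_eq_zero_right h'

theorem antiSelfDual_mul_comm_neg {q s : Fin 3 → ℝ} (h : q ⬝ᵥ s = 0) :
    antiSelfDual s * antiSelfDual q = -(antiSelfDual q * antiSelfDual s) := by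
  have h' := antiSelfDual_mul_add_mul q s
  rw [h, mul_zero, zero_smul] at h'
  exact eq_neg_of_add_eq_zero_right h'

/-- Orthonormal pairs of self-dual and of anti-self-dual two-vectors agree on a common unit
vector. -/
theorem exists_unit_selfDual_mulVec_eq {p r q s : Fin 3 → ℝ} (hp : p ⬝ᵥ p = 1) (hr : r ⬝ᵥ r = 1)
    (hpr : p ⬝ᵥ r = 0) (hq : q ⬝ᵥ q = 1) (hs : s ⬝ᵥ s = 1) (hqs : q ⬝ᵥ s = 0) :
    ∃ y : Fin 4 → ℝ, y ⬝ᵥ y = 1 ∧ antiSelfDual q *ᵥ y = selfDual p *ᵥ y ∧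
      antiSelfDual s *ᵥ y = selfDual r *ᵥ y := by
  have htr := trace_selfDual_mul_mul_antiSelfDual_mul p r q s
  have htPQ := trace_selfDual_mul_antiSelfDual p q
  have htRS := trace_selfDual_mul_antiSelfDual r s
  have hP := selfDual_mul_self hp
  have hR := selfDual_mul_self hr
  have hQ := antiSelfDual_mul_self hq
  have hS := antiSelfDual_mul_self hs
  have hPR := selfDual_mul_comm_neg hpr
  have hQS := antiSelfDual_mul_comm_neg hqs
  have hPQ := (commute_selfDual_antiSelfDual p q).eq
  have hPS := (commute_selfDual_antiSelfDual p s).eq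
  have hRQ := (commute_selfDual_antiSelfDual r q).eq
  have hRS := (commute_selfDual_antiSelfDual r s).eq
  generalize selfDual p = P at *
  generalize selfDual r = R at *
  generalize antiSelfDual q = Q at *
  generalize antiSelfDual s = S at *
  have hcomm : P * Q * (R * S) = P * R * (Q * S) := by
    rw [mul_assoc, ← mul_assoc Q, ← hRQ]; simp only [mul_assoc]
  have hcomm' : P * Q * (R * S) = R * S * (P * Q) := by
    rw [hcomm, mul_assoc R, ← mul_assoc S, ← hPS, ← neg_neg (P * R), ← hPR,
      ← neg_neg (Q * S), ← hQS]
    simp only [neg_mul_neg, mul_assoc]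
  set M := (1 - P * Q) * (1 - R * S) with hM
  have hMtr : M.trace = 4 := by
    have : M = 1 - P * Q - R * S + P * R * (Q * S) := by rw [hM, ← hcomm]; noncomm_ring
    rw [this, trace_add, trace_sub, trace_sub, htr, htPQ, htRS, hpr]
    simp
  have hQM : Q * M = P * M := by
    have h : Q * (1 - P * Q) = P * (1 - P * Q) := by
      rw [mul_sub, mul_sub, ← mul_assoc, ← mul_assoc, ← hPQ, hP, mul_assoc P Q Q, hQ]
      noncomm_ring
    rw [hM, ← mul_assoc, ← mul_assoc, h]
  have hSM : S * M = R * M := by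
    have hM' : M = (1 - R * S) * (1 - P * Q) := by
      rw [hM, sub_mul, mul_sub, mul_sub, sub_mul, mul_sub, mul_sub, hcomm']; noncomm_ring
    have h : S * (1 - R * S) = R * (1 - R * S) := by
      rw [mul_sub, mul_sub, ← mul_assoc, ← mul_assoc, ← hRS, hR, mul_assoc R S S, hS]
      noncomm_ring
    rw [hM', ← mul_assoc, ← mul_assoc, h]
  obtain ⟨x, hx⟩ : ∃ x, M *ᵥ x ≠ 0 := by
    by_contra! h
    have h0 : M = 0 := Matrix.ext_of_mulVec_single fun i => by rw [h, zero_mulVec]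
    simp [h0] at hMtr
  obtain ⟨y, hy, c, hc, hxy⟩ := exists_smul_dotProduct_self_eq_one hx
  have key : ∀ A B : Matrix (Fin 4) (Fin 4) ℝ, A * M = B * M → A *ᵥ y = B *ᵥ y := by
    intro A B h
    apply smul_right_injective _ hc
    simp only [← mulVec_smul, ← hxy, mulVec_mulVec, h]
  exact ⟨y, hy, key _ _ hQM, key _ _ hSM⟩

theorem dotProduct_mulVec_eq_neg {n : Type*} [Fintype n] {A : Matrix n n ℝ} (hA : Aᵀ = -A)
    (v w : n → ℝ) : v ⬝ᵥ A *ᵥ w = -(A *ᵥ v ⬝ᵥ w) := by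
  rw [dotProduct_mulVec, ← mulVec_transpose, hA, neg_mulVec, neg_dotProduct]

theorem dotProduct_mulVec_self_eq_zero {n : Type*} [Fintype n] {A : Matrix n n ℝ} (hA : Aᵀ = -A)
    (v : n → ℝ) : v ⬝ᵥ A *ᵥ v = 0 := by
  have h := dotProduct_mulVec_eq_neg hA v v
  rw [dotProduct_comm (A *ᵥ v)] at h
  linarith

theorem orthonormal_of_anticommuting {P R : Matrix (Fin 4) (Fin 4) ℝ} (hPt : Pᵀ = -P)
    (hRt : Rᵀ = -R) (hP : P * P = -1) (hR : R * R = -1) (hPR : R * P = -(P * R))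
    {y : Fin 4 → ℝ} (hy : y ⬝ᵥ y = 1) :
    Orthonormal ℝ (fun k => WithLp.toLp 2 (![y, P *ᵥ R *ᵥ y, P *ᵥ y, R *ᵥ y] k) :
      Fin 4 → EuclideanSpace ℝ (Fin 4)) := by
  have hPRt : (P * R)ᵀ = -(P * R) := by
    rw [transpose_mul, hPt, hRt, neg_mul_neg, hPR]
  have isoP : ∀ v w : Fin 4 → ℝ, P *ᵥ v ⬝ᵥ P *ᵥ w = v ⬝ᵥ w := fun v w => by
    rw [dotProduct_mulVec_eq_neg hPt, mulVec_mulVec, hP]; simp [neg_mulVec]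
  have isoR : ∀ v w : Fin 4 → ℝ, R *ᵥ v ⬝ᵥ R *ᵥ w = v ⬝ᵥ w := fun v w => by
    rw [dotProduct_mulVec_eq_neg hRt, mulVec_mulVec, hR]; simp [neg_mulVec]
  have h1 := dotProduct_mulVec_self_eq_zero hPt y
  have h2 := dotProduct_mulVec_self_eq_zero hRt y
  have h3 : y ⬝ᵥ P *ᵥ R *ᵥ y = 0 := by
    rw [mulVec_mulVec]; exact dotProduct_mulVec_self_eq_zero hPRt y
  have h4 : P *ᵥ y ⬝ᵥ R *ᵥ y = 0 := by
    have := dotProduct_mulVec_eq_neg hPt y (R *ᵥ y)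
    linarith
  have h5 := dotProduct_mulVec_self_eq_zero hPt (R *ᵥ y)
  rw [orthonormal_iff_ite]
  intro i j
  rw [EuclideanSpace.inner_toLp_toLp, star_trivial]
  fin_cases i <;> fin_cases j <;>
    simp [-mulVec_mulVec, isoP, isoR, hy, h1, h2, h3, h4, h5, dotProduct_comm _ y,
      dotProduct_comm (R *ᵥ y) (P *ᵥ y), dotProduct_comm (P *ᵥ R *ᵥ y) (R *ᵥ y)]

theorem apply_eq_sum_mulVec_mul_of_orthonormal {n : Type*} [Fintype n] [DecidableEq n]
    {e : n → EuclideanSpace ℝ n} (he : Orthonormal ℝ e) (A : Matrix n n ℝ) (i j : n) :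
    A i j = ∑ k, (A *ᵥ (e k).ofLp) i * e k j := by
  let E : Matrix n n ℝ := Matrix.of fun k l => e k l
  have hE : E * Eᵀ = 1 := by
    ext k l
    rw [Matrix.one_apply, ← orthonormal_iff_ite.1 he k l]
    simp [E, Matrix.mul_apply, PiLp.inner_apply, mul_comm]
  have hA : A = A * Eᵀ * E := by rw [mul_assoc, mul_eq_one_comm.1 hE, mul_one]
  conv_lhs => rw [hA]
  simp [Matrix.mul_apply, mulVec, dotProduct, E]

theorem eq_selfDual_add_antiSelfDual {φ : Fin 4 → Fin 4 → ℝ}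
    (hφ : ∀ i j, φ j i = -φ i j) :
    φ = selfDual ![(φ 0 1 + φ 2 3) / 2, (φ 0 2 - φ 1 3) / 2, (φ 0 3 + φ 1 2) / 2] +
      antiSelfDual ![(φ 0 1 - φ 2 3) / 2, (φ 0 2 + φ 1 3) / 2, (φ 0 3 - φ 1 2) / 2] := by
  have hd : ∀ i, φ i i = 0 := fun i => by linarith [hφ i i]
  ext i j
  fin_cases i <;> fin_cases j <;>
    simp [selfDual, antiSelfDual, hd, hφ 0 1, hφ 0 2, hφ 0 3, hφ 1 2, hφ 1 3, hφ 2 3] <;> ring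


open scoped BigOperators

noncomputable section

/-- The two-vector `v ∧ w`, identified with the antisymmetric matrix
`(v ∧ w)_{ij} = v_i w_j - v_j w_i`. -/
def wedgeV (v w : EuclideanSpace ℝ (Fin 4)) : Fin 4 → Fin 4 → ℝ :=
  fun i j => v i * w j - v j * w i

/-- Lemma `linear.algebra.lemma.1`: if `φ ∧ φ = ψ ∧ ψ`, `φ ∧ ψ = 0` and `⟨φ,ψ⟩ = 0`, then in
a suitable orthonormal basis `{e₁,e₂,e₃,e₄}` of `ℝ⁴` one has
`φ = a₁ e₁∧e₃ + a₂ e₄∧e₂` and `ψ = b₁ e₁∧e₄ + b₂ e₂∧e₃` with `a₁a₂ = b₁b₂`. -/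
theorem stmt_15 (φ ψ : Fin 4 → Fin 4 → ℝ)
    (hφa : ∀ i j, φ j i = - φ i j) (hψa : ∀ i j, ψ j i = - ψ i j)
    (hsq : φ 0 1 * φ 2 3 - φ 0 2 * φ 1 3 + φ 0 3 * φ 1 2
         = ψ 0 1 * ψ 2 3 - ψ 0 2 * ψ 1 3 + ψ 0 3 * ψ 1 2)
    (hwed : φ 0 1 * ψ 2 3 + ψ 0 1 * φ 2 3 - φ 0 2 * ψ 1 3 - ψ 0 2 * φ 1 3
          + φ 0 3 * ψ 1 2 + ψ 0 3 * φ 1 2 = 0)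
    (hinner : (1 / 2 : ℝ) * ∑ i : Fin 4, ∑ j : Fin 4, φ i j * ψ i j = 0) :
    ∃ e : Fin 4 → EuclideanSpace ℝ (Fin 4), Orthonormal ℝ e ∧
      ∃ a₁ a₂ b₁ b₂ : ℝ, a₁ * a₂ = b₁ * b₂ ∧
        (∀ i j, φ i j = a₁ * wedgeV (e 0) (e 2) i j + a₂ * wedgeV (e 3) (e 1) i j) ∧
        (∀ i j, ψ i j = b₁ * wedgeV (e 0) (e 3) i j + b₂ * wedgeV (e 1) (e 2) i j) := by
  have hd : ∀ i, φ i i = 0 := fun i => by linarith [hφa i i]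
  simp only [Fin.sum_univ_four, hd, hφa 0 1, hφa 0 2, hφa 0 3, hφa 1 2, hφa 1 3, hφa 2 3,
    hψa 0 1, hψa 0 2, hψa 0 3, hψa 1 2, hψa 1 3, hψa 2 3] at hinner
  have hφ := eq_selfDual_add_antiSelfDual hφa
  have hψ := eq_selfDual_add_antiSelfDual hψa
  set p : Fin 3 → ℝ := ![(φ 0 1 + φ 2 3) / 2, (φ 0 2 - φ 1 3) / 2, (φ 0 3 + φ 1 2) / 2] with hp
  set q : Fin 3 → ℝ := ![(φ 0 1 - φ 2 3) / 2, (φ 0 2 + φ 1 3) / 2, (φ 0 3 - φ 1 2) / 2] with hq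
  set r : Fin 3 → ℝ := ![(ψ 0 1 + ψ 2 3) / 2, (ψ 0 2 - ψ 1 3) / 2, (ψ 0 3 + ψ 1 2) / 2] with hr
  set s : Fin 3 → ℝ := ![(ψ 0 1 - ψ 2 3) / 2, (ψ 0 2 + ψ 1 3) / 2, (ψ 0 3 - ψ 1 2) / 2] with hs
  have hpr : p ⬝ᵥ r = 0 := by
    simp [hp, hr, dotProduct, Fin.sum_univ_three]
    linear_combination hwed / 4 + hinner / 4
  have hqs : q ⬝ᵥ s = 0 := by
    simp [hq, hs, dotProduct, Fin.sum_univ_three]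
    linear_combination hinner / 4 - hwed / 4
  have hnorm : p ⬝ᵥ p - q ⬝ᵥ q = r ⬝ᵥ r - s ⬝ᵥ s := by
    simp [hp, hq, hr, hs, dotProduct, Fin.sum_univ_three]
    linear_combination hsq
  clear_value p q r s
  obtain ⟨p', r', hp', hr', hpr', α, γ, rfl, rfl⟩ := exists_orthonormal_pair_smul hpr
  obtain ⟨q', s', hq', hs', hqs', β, δ, rfl, rfl⟩ := exists_orthonormal_pair_smul hqs
  obtain ⟨y, hy, hQy, hSy⟩ := exists_unit_selfDual_mulVec_eq hp' hr' hpr' hq' hs' hqs'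
  have hP := selfDual_mul_self hp'
  have hR := selfDual_mul_self hr'
  have hPR := selfDual_mul_comm_neg hpr'
  have he := orthonormal_of_anticommuting (transpose_selfDual p') (transpose_selfDual r')
    hP hR hPR hy
  rw [selfDual_smul, antiSelfDual_smul] at hφ hψ
  have hPQ := (commute_selfDual_antiSelfDual p' q').eq
  have hPS := (commute_selfDual_antiSelfDual p' s').eq
  have hRQ := (commute_selfDual_antiSelfDual r' q').eq
  have hRS := (commute_selfDual_antiSelfDual r' s').eq
  generalize selfDual p' = P at *
  generalize selfDual r' = R at *
  generalize antiSelfDual q' = Q at *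
  generalize antiSelfDual s' = S at *
  have P2 (v) : P *ᵥ P *ᵥ v = -v := by rw [mulVec_mulVec, hP, neg_mulVec, one_mulVec]
  have R2 (v) : R *ᵥ R *ᵥ v = -v := by rw [mulVec_mulVec, hR, neg_mulVec, one_mulVec]
  have RP (v) : R *ᵥ P *ᵥ v = -(P *ᵥ R *ᵥ v) := by
    rw [mulVec_mulVec, hPR, neg_mulVec, mulVec_mulVec]
  have QP (v) : Q *ᵥ P *ᵥ v = P *ᵥ Q *ᵥ v := by rw [mulVec_mulVec, ← hPQ, mulVec_mulVec]
  have SP (v) : S *ᵥ P *ᵥ v = P *ᵥ S *ᵥ v := by rw [mulVec_mulVec, ← hPS, mulVec_mulVec]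
  have QR (v) : Q *ᵥ R *ᵥ v = R *ᵥ Q *ᵥ v := by rw [mulVec_mulVec, ← hRQ, mulVec_mulVec]
  have SR (v) : S *ᵥ R *ᵥ v = R *ᵥ S *ᵥ v := by rw [mulVec_mulVec, ← hRS, mulVec_mulVec]
  refine ⟨_, he, -(α + β), -(α - β), -(γ + δ), -(γ - δ), ?_, fun i j => ?_, fun i j => ?_⟩
  · simp only [smul_dotProduct, dotProduct_smul, smul_eq_mul, hp', hq', hr', hs'] at hnorm
    linear_combination hnorm
  · rw [hφ]
    refine (apply_eq_sum_mulVec_mul_of_orthonormal he (α • P + β • Q) i j).trans ?_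
    simp [-mulVec_mulVec, Fin.sum_univ_four, wedgeV, add_mulVec, smul_mulVec,
      mulVec_neg, P2, QP, QR, RP, hQy]
    ring
  · rw [hψ]
    refine (apply_eq_sum_mulVec_mul_of_orthonormal he (γ • R + δ • S) i j).trans ?_
    simp [-mulVec_mulVec, Fin.sum_univ_four, wedgeV, add_mulVec, smul_mulVec,
      mulVec_neg, R2, SP, SR, RP, hSy]
    ring
end
end

section
/- Let φ, ψ ∈ Λ²ℝ⁴ be two-vectors satisfying φ ∧ φ = ψ ∧ ψ and φ ∧ ψ = 0. Then there exists an orthonormal basis {e1,e2,e3,e4} of ℝ⁴ and real numbers a1, a2, b1, b2, θ with a1·a2 = b1·b2 such that cos θ · φ + sin θ · ψ = a1 e1∧e3 + a2 e4∧e2 and -sin θ · φ + cos θ · ψ = b1 e1∧e4 + b2 e2∧e3. -/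
open scoped BigOperators

noncomputable section

open Matrix

/-- The matrix of left multiplication by the imaginary quaternion with coordinates `u`. -/
def leftMat (u : Fin 3 → ℝ) : Matrix (Fin 4) (Fin 4) ℝ :=
  !![0, -u 0, -u 1, -u 2; u 0, 0, -u 2, u 1; u 1, u 2, 0, -u 0; u 2, -u 1, u 0, 0]

/-- The matrix of right multiplication by the imaginary quaternion with coordinates `v`. -/
def rightMat (v : Fin 3 → ℝ) : Matrix (Fin 4) (Fin 4) ℝ :=
  !![0, -v 0, -v 1, -v 2; v 0, 0, v 2, -v 1; v 1, -v 2, 0, v 0; v 2, v 1, -v 0, 0]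

lemma leftMat_smul (c : ℝ) (u : Fin 3 → ℝ) : leftMat (c • u) = c • leftMat u := by
  ext i j
  fin_cases i <;> fin_cases j <;> simp [leftMat]

lemma rightMat_smul (c : ℝ) (u : Fin 3 → ℝ) : rightMat (c • u) = c • rightMat u := by
  ext i j
  fin_cases i <;> fin_cases j <;> simp [rightMat]

lemma leftMat_transpose (u : Fin 3 → ℝ) : (leftMat u)ᵀ = -leftMat u := by
  ext i j
  fin_cases i <;> fin_cases j <;> simp [leftMat]

lemma leftMat_anticomm (u v : Fin 3 → ℝ) :
    leftMat u * leftMat v + leftMat v * leftMat u = (-2 * (u ⬝ᵥ v)) • 1 := by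
  ext i j
  fin_cases i <;> fin_cases j <;>
    simp [leftMat, Fin.sum_univ_succ, dotProduct] <;> ring

lemma rightMat_anticomm (u v : Fin 3 → ℝ) :
    rightMat u * rightMat v + rightMat v * rightMat u = (-2 * (u ⬝ᵥ v)) • 1 := by
  ext i j
  fin_cases i <;> fin_cases j <;>
    simp [rightMat, Fin.sum_univ_succ, dotProduct] <;> ring

lemma rightMat_mul_leftMat (u v : Fin 3 → ℝ) :
    rightMat v * leftMat u = leftMat u * rightMat v := by
  ext i j
  fin_cases i <;> fin_cases j <;>
    simp [leftMat, rightMat, Matrix.mul_apply, Fin.sum_univ_succ] <;> ring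

lemma trace_leftMat_mul_rightMat (u v : Fin 3 → ℝ) :
    (leftMat u * rightMat v).trace = 0 := by
  simp [leftMat, rightMat, Matrix.trace, Fin.sum_univ_succ]
  ring

lemma trace_leftMat_mul_leftMat_mul_rightMat_mul_rightMat (u v s q : Fin 3 → ℝ) :
    (leftMat u * leftMat v * (rightMat s * rightMat q)).trace = 4 * (u ⬝ᵥ v) * (s ⬝ᵥ q) := by
  simp [leftMat, rightMat, Matrix.trace, Fin.sum_univ_succ, dotProduct]
  ring

lemma leftMat_mul_self {u : Fin 3 → ℝ} (hu : u ⬝ᵥ u = 1) : leftMat u * leftMat u = -1 := by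
  have h := leftMat_anticomm u u
  rw [hu] at h
  ext i j
  have := congrFun₂ h i j
  simp at this ⊢
  linarith

lemma rightMat_mul_self {u : Fin 3 → ℝ} (hu : u ⬝ᵥ u = 1) : rightMat u * rightMat u = -1 := by
  have h := rightMat_anticomm u u
  rw [hu] at h
  ext i j
  have := congrFun₂ h i j
  simp at this ⊢
  linarith

lemma leftMat_mul_comm_neg {u v : Fin 3 → ℝ} (h : u ⬝ᵥ v = 0) :
    leftMat v * leftMat u = -(leftMat u * leftMat v) := by
  have := leftMat_anticomm u v
  rw [h, mul_zero, zero_smul] at this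
  exact eq_neg_of_add_eq_zero_right this

lemma rightMat_mul_comm_neg {u v : Fin 3 → ℝ} (h : u ⬝ᵥ v = 0) :
    rightMat v * rightMat u = -(rightMat u * rightMat v) := by
  have := rightMat_anticomm u v
  rw [h, mul_zero, zero_smul] at this
  exact eq_neg_of_add_eq_zero_right this

lemma dotProduct_self_pos_of_ne_zero {n : ℕ} {a : Fin n → ℝ} (ha : a ≠ 0) : 0 < a ⬝ᵥ a :=
  lt_of_le_of_ne (Finset.sum_nonneg fun i _ => mul_self_nonneg (a i))
    fun h => ha (dotProduct_self_eq_zero.1 h.symm)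

lemma exists_unit_smul_of_ne_zero {n : ℕ} {a : Fin n → ℝ} (ha : a ≠ 0) :
    ∃ c : ℝ, c ≠ 0 ∧ (c • a) ⬝ᵥ (c • a) = 1 := by
  have h := dotProduct_self_pos_of_ne_zero ha
  have h2 := Real.sq_sqrt h.le
  have h3 := Real.sqrt_pos.2 h
  refine ⟨(√(a ⬝ᵥ a))⁻¹, by positivity, ?_⟩
  rw [smul_dotProduct, dotProduct_smul, smul_eq_mul, smul_eq_mul]
  field_simp
  exact h2.symm

lemma exists_unit_orthogonal (v : Fin 3 → ℝ) : ∃ w : Fin 3 → ℝ, w ⬝ᵥ w = 1 ∧ v ⬝ᵥ w = 0 := by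
  obtain ⟨w, hw, hvw⟩ : ∃ w : Fin 3 → ℝ, w ≠ 0 ∧ v ⬝ᵥ w = 0 := by
    by_cases h : v 0 = 0
    · refine ⟨![1, 0, 0], fun h' => ?_, ?_⟩
      · simpa using congrFun h' 0
      · simp [dotProduct, Fin.sum_univ_succ, h]
    · refine ⟨![-v 1, v 0, 0], fun h' => h ?_, ?_⟩
      · simpa using congrFun h' 1
      · simp [dotProduct, Fin.sum_univ_succ]
        ring
  obtain ⟨c, -, hc⟩ := exists_unit_smul_of_ne_zero hw
  exact ⟨c • w, hc, by rw [dotProduct_smul, hvw, smul_zero]⟩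

lemma exists_unit_eq_smul {n : ℕ} {a : Fin n → ℝ} (ha : a ≠ 0) :
    ∃ (p : Fin n → ℝ) (α c : ℝ), p ⬝ᵥ p = 1 ∧ a = α • p ∧ p = c • a := by
  obtain ⟨c, hc0, hc⟩ := exists_unit_smul_of_ne_zero ha
  exact ⟨c • a, c⁻¹, c, hc, by rw [smul_smul, inv_mul_cancel₀ hc0, one_smul], rfl⟩

lemma exists_orthonormal_pair_of_dotProduct_eq_zero {a b : Fin 3 → ℝ} (h : a ⬝ᵥ b = 0) :
    ∃ (p r : Fin 3 → ℝ) (α β : ℝ), p ⬝ᵥ p = 1 ∧ r ⬝ᵥ r = 1 ∧ p ⬝ᵥ r = 0 ∧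
      a = α • p ∧ b = β • r := by
  by_cases ha : a = 0
  · obtain ⟨r, β, hr, hb⟩ : ∃ (r : Fin 3 → ℝ) (β : ℝ), r ⬝ᵥ r = 1 ∧ b = β • r := by
      by_cases hb : b = 0
      · obtain ⟨r, hr, -⟩ := exists_unit_orthogonal 0
        exact ⟨r, 0, hr, by simp [hb]⟩
      · obtain ⟨r, β, -, hr, hb, -⟩ := exists_unit_eq_smul hb
        exact ⟨r, β, hr, hb⟩
    obtain ⟨p, hp, hrp⟩ := exists_unit_orthogonal r
    exact ⟨p, r, 0, β, hp, hr, by rw [dotProduct_comm, hrp], by simp [ha], hb⟩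
  · obtain ⟨p, α, c, hp, hpa, hpc⟩ := exists_unit_eq_smul ha
    by_cases hb : b = 0
    · obtain ⟨r, hr, hpr⟩ := exists_unit_orthogonal p
      exact ⟨p, r, α, 0, hp, hr, hpr, hpa, by simp [hb]⟩
    · obtain ⟨r, β, d, hr, hrb, hrd⟩ := exists_unit_eq_smul hb
      refine ⟨p, r, α, β, hp, hr, ?_, hpa, hrb⟩
      rw [hpc, hrd, smul_dotProduct, dotProduct_smul, h, smul_zero, smul_zero]

/-- The averaging element of two commuting quaternionic structures intertwines them. -/
lemma intertwining_of_quaternion_relations {R : Type*} [Ring R] {A B C D : R}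
    (hAA : A * A = -1) (hBB : B * B = -1) (hBA : B * A = -(A * B))
    (hCC : C * C = -1) (hDD : D * D = -1) (hDC : D * C = -(C * D))
    (hCA : C * A = A * C) (hCB : C * B = B * C) (hDA : D * A = A * D) (hDB : D * B = B * D) :
    C * (1 - A * C - B * D - A * B * (D * C)) = A * (1 - A * C - B * D - A * B * (D * C)) ∧
      D * (1 - A * C - B * D - A * B * (D * C))
        = B * (1 - A * C - B * D - A * B * (D * C)) := by
  have assoc : ∀ {x y z : R}, x * y = z → ∀ w, x * (y * w) = z * w := fun h w => by
    rw [← mul_assoc, h]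
  constructor <;>
  · simp only [mul_sub, mul_one, mul_assoc, hCC, hDD, hDC,
      assoc hAA, assoc hBB, assoc hBA, assoc hCC, assoc hDC, assoc hCA, assoc hCB,
      assoc hDA, assoc hDB, mul_neg, neg_mul, one_mul, neg_neg]
    abel

/-- Two orthonormal pairs of imaginary quaternions are conjugate: there is a unit quaternion `x`
with `p x = x q` and `r x = x s`. -/
lemma exists_unit_intertwiner {p r q s : Fin 3 → ℝ} (hp : p ⬝ᵥ p = 1) (hr : r ⬝ᵥ r = 1)
    (hpr : p ⬝ᵥ r = 0) (hq : q ⬝ᵥ q = 1) (hs : s ⬝ᵥ s = 1) (hqs : q ⬝ᵥ s = 0) :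
    ∃ x : Fin 4 → ℝ, x ⬝ᵥ x = 1 ∧ rightMat q *ᵥ x = leftMat p *ᵥ x ∧
      rightMat s *ᵥ x = leftMat r *ᵥ x := by
  have hAA := leftMat_mul_self hp
  have hBB := leftMat_mul_self hr
  have hBA := leftMat_mul_comm_neg hpr
  have hCC := rightMat_mul_self hq
  have hDD := rightMat_mul_self hs
  have hDC := rightMat_mul_comm_neg hqs
  have hCA := rightMat_mul_leftMat p q
  have hCB := rightMat_mul_leftMat r q
  have hDA := rightMat_mul_leftMat p s
  have hDB := rightMat_mul_leftMat r s
  have htr1 := trace_leftMat_mul_rightMat p q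
  have htr2 := trace_leftMat_mul_rightMat r s
  have htr3 := trace_leftMat_mul_leftMat_mul_rightMat_mul_rightMat p r s q
  rw [hpr, mul_zero, zero_mul] at htr3
  generalize leftMat p = A at *
  generalize leftMat r = B at *
  generalize rightMat q = C at *
  generalize rightMat s = D at *
  set P := 1 - A * C - B * D - A * B * (D * C) with hP
  have hPne : P ≠ 0 := by
    intro h
    have := congrArg Matrix.trace h
    simp [hP, Matrix.trace_sub, htr1, htr2, htr3] at this
  obtain ⟨hCP, hDP⟩ : C * P = A * P ∧ D * P = B * P :=
    intertwining_of_quaternion_relations hAA hBB hBA hCC hDD hDC hCA hCB hDA hDB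
  obtain ⟨y, hy⟩ : ∃ y, P *ᵥ y ≠ 0 := by
    by_contra! h
    exact hPne (Matrix.ext_of_mulVec_single fun i => by rw [h, Matrix.zero_mulVec])
  obtain ⟨c, -, hc⟩ := exists_unit_smul_of_ne_zero hy
  refine ⟨c • P *ᵥ y, hc, ?_, ?_⟩
  · rw [Matrix.mulVec_smul, Matrix.mulVec_smul, Matrix.mulVec_mulVec, Matrix.mulVec_mulVec, hCP]
  · rw [Matrix.mulVec_smul, Matrix.mulVec_smul, Matrix.mulVec_mulVec, Matrix.mulVec_mulVec, hDP]

lemma apply_eq_sum_mulVec_mul {n : ℕ} (M : Matrix (Fin n) (Fin n) ℝ) {f : Fin n → Fin n → ℝ}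
    (hf : ∀ c d, f c ⬝ᵥ f d = if c = d then 1 else 0) (i j : Fin n) :
    M i j = ∑ c, (M *ᵥ f c) i * f c j := by
  have h1 : Matrix.of f * (Matrix.of f)ᵀ = 1 := by
    ext c d
    simpa [Matrix.mul_apply, dotProduct, Matrix.one_apply] using hf c d
  have h2 := mul_eq_one_comm.1 h1
  have h3 : M = (M * (Matrix.of f)ᵀ) * Matrix.of f := by rw [Matrix.mul_assoc, h2, mul_one]
  conv_lhs => rw [h3]
  rfl

lemma orthonormal_quaternionic_frame {A B : Matrix (Fin 4) (Fin 4) ℝ} (hA : Aᵀ = -A)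
    (hB : Bᵀ = -B) (hAA : A * A = -1) (hBB : B * B = -1) (hBA : B * A = -(A * B))
    {x : Fin 4 → ℝ} (hx : x ⬝ᵥ x = 1) (c d : Fin 4) :
    ![x, (A * B) *ᵥ x, -(A *ᵥ x), -(B *ᵥ x)] c ⬝ᵥ ![x, (A * B) *ᵥ x, -(A *ᵥ x), -(B *ᵥ x)] d
      = if c = d then 1 else 0 := by
  have key : ∀ M N : Matrix (Fin 4) (Fin 4) ℝ,
      (M *ᵥ x) ⬝ᵥ (N *ᵥ x) = x ⬝ᵥ ((Mᵀ * N) *ᵥ x) := fun M N => by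
    rw [← Matrix.mulVec_mulVec, Matrix.dotProduct_mulVec x, Matrix.vecMul_transpose]
  have skew : ∀ M : Matrix (Fin 4) (Fin 4) ℝ, Mᵀ = -M → x ⬝ᵥ (M *ᵥ x) = 0 := fun M hM => by
    have h : x ⬝ᵥ (M *ᵥ x) = -(x ⬝ᵥ (M *ᵥ x)) := by
      conv_lhs => rw [Matrix.dotProduct_mulVec, ← Matrix.mulVec_transpose, hM, dotProduct_comm,
        Matrix.neg_mulVec, dotProduct_neg]
    linarith
  have hAB : (A * B)ᵀ = -(A * B) := by rw [Matrix.transpose_mul, hA, hB, neg_mul_neg, hBA]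
  have hAAB : A * (A * B) = -B := by rw [← mul_assoc, hAA, neg_one_mul]
  have hBAB : B * (A * B) = A := by
    rw [← mul_assoc, hBA, neg_mul, mul_assoc, hBB, mul_neg_one, neg_neg]
  have h01 := skew _ hAB
  have h02 := skew _ hA
  have h03 := skew _ hB
  have h11 : ((A * B) *ᵥ x) ⬝ᵥ ((A * B) *ᵥ x) = 1 := by
    rw [key, hAB, neg_mul, mul_assoc, hBAB, hAA, neg_neg, Matrix.one_mulVec, hx]
  have h22 : (A *ᵥ x) ⬝ᵥ (A *ᵥ x) = 1 := by
    rw [key, hA, neg_mul, hAA, neg_neg, Matrix.one_mulVec, hx]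
  have h33 : (B *ᵥ x) ⬝ᵥ (B *ᵥ x) = 1 := by
    rw [key, hB, neg_mul, hBB, neg_neg, Matrix.one_mulVec, hx]
  have h12 : (A *ᵥ x) ⬝ᵥ ((A * B) *ᵥ x) = 0 := by
    rw [key, hA, neg_mul, hAAB, neg_neg, h03]
  have h13 : (B *ᵥ x) ⬝ᵥ ((A * B) *ᵥ x) = 0 := by
    rw [key, hB, neg_mul, hBAB, Matrix.neg_mulVec, dotProduct_neg, h02, neg_zero]
  have h23 : (A *ᵥ x) ⬝ᵥ (B *ᵥ x) = 0 := by
    rw [key, hA, neg_mul, Matrix.neg_mulVec, dotProduct_neg, h01, neg_zero]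
  fin_cases c <;> fin_cases d <;>
    simp [hx, h01, h02, h03, h11, h22, h33, h12, h13, h23, dotProduct_comm _ x,
      dotProduct_comm ((A * B) *ᵥ x), dotProduct_comm (B *ᵥ x) (A *ᵥ x)]

/-- The imaginary quaternion representing the self-dual part of a two-vector. -/
def selfDualPart (φ : Fin 4 → Fin 4 → ℝ) : Fin 3 → ℝ :=
  ![-(φ 0 1 + φ 2 3) / 2, (φ 1 3 - φ 0 2) / 2, -(φ 0 3 + φ 1 2) / 2]

/-- The imaginary quaternion representing the anti-self-dual part of a two-vector. -/
def antiSelfDualPart (φ : Fin 4 → Fin 4 → ℝ) : Fin 3 → ℝ :=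
  ![(φ 2 3 - φ 0 1) / 2, -(φ 0 2 + φ 1 3) / 2, (φ 1 2 - φ 0 3) / 2]

lemma of_eq_leftMat_add_rightMat {φ : Fin 4 → Fin 4 → ℝ} (h : ∀ i j, φ j i = -φ i j) :
    Matrix.of φ = leftMat (selfDualPart φ) + rightMat (antiSelfDualPart φ) := by
  have hd : ∀ i, φ i i = 0 := fun i => by linarith [h i i]
  ext i j
  fin_cases i <;> fin_cases j <;>
    simp [leftMat, rightMat, selfDualPart, antiSelfDualPart, hd, h 0 1, h 0 2, h 0 3, h 1 2,
      h 1 3, h 2 3] <;> ring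

lemma dotProduct_selfDualPart_sub (φ ψ : Fin 4 → Fin 4 → ℝ) :
    selfDualPart φ ⬝ᵥ selfDualPart ψ - antiSelfDualPart φ ⬝ᵥ antiSelfDualPart ψ
      = (φ 0 1 * ψ 2 3 + ψ 0 1 * φ 2 3 - φ 0 2 * ψ 1 3 - ψ 0 2 * φ 1 3
          + φ 0 3 * ψ 1 2 + ψ 0 3 * φ 1 2) / 2 := by
  simp [selfDualPart, antiSelfDualPart, dotProduct, Fin.sum_univ_succ]
  ring

/-- If the self-dual parts of `φ` and `ψ` are orthogonal, no rotation is needed. -/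
lemma exists_frame_of_selfDualPart_orthogonal {φ ψ : Fin 4 → Fin 4 → ℝ}
    (hφa : ∀ i j, φ j i = -φ i j) (hψa : ∀ i j, ψ j i = -ψ i j)
    (hsq : φ 0 1 * φ 2 3 - φ 0 2 * φ 1 3 + φ 0 3 * φ 1 2
         = ψ 0 1 * ψ 2 3 - ψ 0 2 * ψ 1 3 + ψ 0 3 * ψ 1 2)
    (hwed : φ 0 1 * ψ 2 3 + ψ 0 1 * φ 2 3 - φ 0 2 * ψ 1 3 - ψ 0 2 * φ 1 3
          + φ 0 3 * ψ 1 2 + ψ 0 3 * φ 1 2 = 0)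
    (hsd : selfDualPart φ ⬝ᵥ selfDualPart ψ = 0) :
    ∃ e : Fin 4 → EuclideanSpace ℝ (Fin 4), Orthonormal ℝ e ∧
      ∃ a₁ a₂ b₁ b₂ : ℝ, a₁ * a₂ = b₁ * b₂ ∧
        (∀ i j, φ i j = a₁ * wedgeV (e 0) (e 2) i j + a₂ * wedgeV (e 3) (e 1) i j) ∧
        (∀ i j, ψ i j = b₁ * wedgeV (e 0) (e 3) i j + b₂ * wedgeV (e 1) (e 2) i j) := by
  have hasd : antiSelfDualPart φ ⬝ᵥ antiSelfDualPart ψ = 0 := by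
    linarith [dotProduct_selfDualPart_sub φ ψ]
  have hnorm : selfDualPart φ ⬝ᵥ selfDualPart φ - antiSelfDualPart φ ⬝ᵥ antiSelfDualPart φ
      = selfDualPart ψ ⬝ᵥ selfDualPart ψ - antiSelfDualPart ψ ⬝ᵥ antiSelfDualPart ψ := by
    linarith [dotProduct_selfDualPart_sub φ φ, dotProduct_selfDualPart_sub ψ ψ]
  obtain ⟨p, r, α, β, hp, hr, hpr, hα, hβ⟩ := exists_orthonormal_pair_of_dotProduct_eq_zero hsd
  obtain ⟨q, s, γ, δ, hq, hs, hqs, hγ, hδ⟩ := exists_orthonormal_pair_of_dotProduct_eq_zero hasd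
  obtain ⟨x, hx, hCx, hDx⟩ := exists_unit_intertwiner hp hr hpr hq hs hqs
  have hφ := of_eq_leftMat_add_rightMat hφa
  have hψ := of_eq_leftMat_add_rightMat hψa
  simp only [hα, hβ, hγ, hδ, smul_dotProduct, dotProduct_smul, hp, hr, hq, hs,
    smul_eq_mul, mul_one] at hnorm
  rw [hα, hγ, leftMat_smul, rightMat_smul] at hφ
  rw [hβ, hδ, leftMat_smul, rightMat_smul] at hψ
  have hAA := leftMat_mul_self hp
  have hBB := leftMat_mul_self hr
  have hBA := leftMat_mul_comm_neg hpr
  have hCA := rightMat_mul_leftMat p q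
  have hCB := rightMat_mul_leftMat r q
  have hDA := rightMat_mul_leftMat p s
  have hDB := rightMat_mul_leftMat r s
  have hf := orthonormal_quaternionic_frame (leftMat_transpose p) (leftMat_transpose r)
    hAA hBB hBA hx
  generalize leftMat p = A at *
  generalize leftMat r = B at *
  generalize rightMat q = C at *
  generalize rightMat s = D at *
  have hBAv : ∀ y, B *ᵥ A *ᵥ y = -(A *ᵥ B *ᵥ y) := fun y => by simp [hBA, Matrix.neg_mulVec]
  have hAAv : ∀ y, A *ᵥ A *ᵥ y = -y := fun y => by simp [hAA, Matrix.neg_mulVec]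
  have hBBv : ∀ y, B *ᵥ B *ᵥ y = -y := fun y => by simp [hBB, Matrix.neg_mulVec]
  have hCAv : ∀ y, C *ᵥ A *ᵥ y = A *ᵥ C *ᵥ y := fun y => by simp [hCA]
  have hCBv : ∀ y, C *ᵥ B *ᵥ y = B *ᵥ C *ᵥ y := fun y => by simp [hCB]
  have hDAv : ∀ y, D *ᵥ A *ᵥ y = A *ᵥ D *ᵥ y := fun y => by simp [hDA]
  have hDBv : ∀ y, D *ᵥ B *ᵥ y = B *ᵥ D *ᵥ y := fun y => by simp [hDB]
  refine ⟨fun c => WithLp.toLp 2 (![x, (A * B) *ᵥ x, -(A *ᵥ x), -(B *ᵥ x)] c), ?_,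
    α + γ, α - γ, β + δ, β - δ, by linarith, fun i j => ?_, fun i j => ?_⟩
  · rw [orthonormal_iff_ite]
    intro c d
    rw [← hf c d, dotProduct_comm]
    simp [EuclideanSpace.inner_eq_star_dotProduct]
  · have h := apply_eq_sum_mulVec_mul (Matrix.of φ) hf i j
    rw [Matrix.of_apply] at h
    rw [h, hφ]
    simp only [Fin.sum_univ_four, ← Matrix.mulVec_mulVec, wedgeV]
    simp [Matrix.add_mulVec, Matrix.smul_mulVec, Matrix.mulVec_neg, -Matrix.mulVec_mulVec,
      hBAv, hAAv, hCAv, hCBv, hCx]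
    ring
  · have h := apply_eq_sum_mulVec_mul (Matrix.of ψ) hf i j
    rw [Matrix.of_apply] at h
    rw [h, hψ]
    simp only [Fin.sum_univ_four, ← Matrix.mulVec_mulVec, wedgeV]
    simp [Matrix.add_mulVec, Matrix.smul_mulVec, Matrix.mulVec_neg, -Matrix.mulVec_mulVec,
      hBAv, hBBv, hDAv, hDBv, hDx]
    ring

lemma exists_angle_mul_cos_add_mul_sin_eq_zero (C D : ℝ) :
    ∃ θ : ℝ, C * Real.cos (2 * θ) + D * Real.sin (2 * θ) = 0 := by
  refine ⟨Complex.arg ⟨D, -C⟩ / 2, ?_⟩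
  have h1 := Complex.norm_mul_cos_arg ⟨D, -C⟩
  have h2 := Complex.norm_mul_sin_arg ⟨D, -C⟩
  rw [mul_div_cancel₀ _ two_ne_zero]
  simp only at h1 h2
  linear_combination (-Real.sin (Complex.arg ⟨D, -C⟩)) * h1
    + Real.cos (Complex.arg ⟨D, -C⟩) * h2

/-- Lemma `linear.algebra.lemma.2`: if `φ ∧ φ = ψ ∧ ψ` and `φ ∧ ψ = 0`, then for a suitable
rotation angle `θ` and orthonormal basis `{e₁,e₂,e₃,e₄}` of `ℝ⁴` one has
`cos θ · φ + sin θ · ψ = a₁ e₁∧e₃ + a₂ e₄∧e₂` and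
`-sin θ · φ + cos θ · ψ = b₁ e₁∧e₄ + b₂ e₂∧e₃` with `a₁a₂ = b₁b₂`. -/
theorem stmt_16 (φ ψ : Fin 4 → Fin 4 → ℝ)
    (hφa : ∀ i j, φ j i = - φ i j) (hψa : ∀ i j, ψ j i = - ψ i j)
    (hsq : φ 0 1 * φ 2 3 - φ 0 2 * φ 1 3 + φ 0 3 * φ 1 2
         = ψ 0 1 * ψ 2 3 - ψ 0 2 * ψ 1 3 + ψ 0 3 * ψ 1 2)
    (hwed : φ 0 1 * ψ 2 3 + ψ 0 1 * φ 2 3 - φ 0 2 * ψ 1 3 - ψ 0 2 * φ 1 3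
          + φ 0 3 * ψ 1 2 + ψ 0 3 * φ 1 2 = 0) :
    ∃ e : Fin 4 → EuclideanSpace ℝ (Fin 4), Orthonormal ℝ e ∧
      ∃ a₁ a₂ b₁ b₂ θ : ℝ, a₁ * a₂ = b₁ * b₂ ∧
        (∀ i j, Real.cos θ * φ i j + Real.sin θ * ψ i j
          = a₁ * wedgeV (e 0) (e 2) i j + a₂ * wedgeV (e 3) (e 1) i j) ∧
        (∀ i j, - Real.sin θ * φ i j + Real.cos θ * ψ i j
          = b₁ * wedgeV (e 0) (e 3) i j + b₂ * wedgeV (e 1) (e 2) i j) := by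
  obtain ⟨θ, hθ⟩ := exists_angle_mul_cos_add_mul_sin_eq_zero
    (selfDualPart φ ⬝ᵥ selfDualPart ψ)
    ((selfDualPart ψ ⬝ᵥ selfDualPart ψ - selfDualPart φ ⬝ᵥ selfDualPart φ) / 2)
  rw [Real.cos_two_mul', Real.sin_two_mul] at hθ
  obtain ⟨e, he, a₁, a₂, b₁, b₂, hab, h1, h2⟩ := exists_frame_of_selfDualPart_orthogonal
    (φ := fun i j => Real.cos θ * φ i j + Real.sin θ * ψ i j)
    (ψ := fun i j => -Real.sin θ * φ i j + Real.cos θ * ψ i j)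
    (fun i j => by rw [hφa i j, hψa i j]; ring) (fun i j => by rw [hφa i j, hψa i j]; ring)
    (by linear_combination (Real.cos θ ^ 2 - Real.sin θ ^ 2) * hsq
          + 2 * Real.cos θ * Real.sin θ * hwed)
    (by linear_combination (-2 * Real.cos θ * Real.sin θ) * hsq
          + (Real.cos θ ^ 2 - Real.sin θ ^ 2) * hwed)
    (by
      simp [selfDualPart, dotProduct, Fin.sum_univ_succ] at hθ ⊢
      linear_combination hθ)
  exact ⟨e, he, a₁, a₂, b₁, b₂, θ, hab, h1, h2⟩
end
end

section
/- For any algebraic curvature tensor R on E and any orthonormal basis e_1,…,e_n, the following identity holds: Q(R)_{1313} + Q(R)_{1414} + Q(R)_{2323} + Q(R)_{2424} - 2 Q(R)_{1234} = Σ_{p,q=1}^n (R_{13pq} - R_{24pq})² + Σ_{p,q=1}^n (R_{14pq} + R_{23pq})² + 2 Σ_{p,q=1}^n (R_{1p1q} + R_{2p2q})(R_{3p3q} + R_{4p4q}) - 2 Σ_{p,q=1}^n R_{12pq} R_{34pq} - 2 Σ_{p,q=1}^n (R_{1p3q} + R_{2p4q})(R_{3p1q} + R_{4p2q}) - 2 Σ_{p,q=1}^n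 (R_{1p4q} - R_{2p3q})(R_{4p1q} - R_{3p2q}). -/
open scoped BigOperators
open RealInnerProductSpace

noncomputable section

/-- The Hamilton quadratic term `Q(R)_{ijkl}` in the orthonormal basis `b`. -/
def Qc {n : ℕ} (R : CurvMap n) (b : OrthonormalBasis (Fin n) ℝ (Euc n))
    (i j k l : Fin n) : ℝ :=
  ∑ p : Fin n, ∑ q : Fin n,
    (R (b i) (b j) (b p) (b q) * R (b k) (b l) (b p) (b q)
      + 2 * R (b i) (b p) (b k) (b q) * R (b j) (b p) (b l) (b q)
      - 2 * R (b i) (b p) (b l) (b q) * R (b j) (b p) (b k) (b q))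

/-- The pair symmetry turns an exchange of the summation indices into an exchange of the
remaining arguments. -/
theorem IsCurvatureTensor.sum_mul_swap {n : ℕ} {R : CurvMap n} (hR : IsCurvatureTensor R)
    {ι : Type*} [Fintype ι] (b : ι → Euc n) (x y z w : Euc n) :
    ∑ p, ∑ q, R x (b p) y (b q) * R z (b p) w (b q)
      = ∑ p, ∑ q, R y (b p) x (b q) * R w (b p) z (b q) := by
  rw [Finset.sum_comm]
  refine Finset.sum_congr rfl fun p _ => Finset.sum_congr rfl fun q _ => ?_
  rw [hR.2.1 x (b q) y (b p), hR.2.1 z (b q) w (b p)]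

/-- The first Bianchi identity, solved for a value with the arguments `x, y` in one pair. -/
theorem IsCurvatureTensor.apply_eq_sub {n : ℕ} {R : CurvMap n} (hR : IsCurvatureTensor R)
    (x y u v : Euc n) :
    R x y u v = R x u y v - R y u x v := by
  have h₁ := hR.2.2 x y u v
  have h₂ := hR.1 u x y v
  linarith

/-- The Bianchi identity expresses the contraction of two curvature operators through
contractions over the second and fourth arguments. -/
theorem IsCurvatureTensor.sum_mul_eq {n : ℕ} {R : CurvMap n} (hR : IsCurvatureTensor R)
    {ι : Type*} [Fintype ι] (b : ι → Euc n) (x y z w : Euc n) :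
    ∑ p, ∑ q, R x y (b p) (b q) * R z w (b p) (b q)
      = 2 * ∑ p, ∑ q, R x (b p) y (b q) * R z (b p) w (b q)
        - 2 * ∑ p, ∑ q, R x (b p) y (b q) * R w (b p) z (b q) := by
  have h₁ := hR.sum_mul_swap b x y z w
  have h₂ := hR.sum_mul_swap b x y w z
  simp only [hR.apply_eq_sub x y, hR.apply_eq_sub z w, sub_mul, mul_sub,
    Finset.sum_sub_distrib]
  linarith

/-- The algebraic identity expressing
`Q(R)₁₃₁₃ + Q(R)₁₄₁₄ + Q(R)₂₃₂₃ + Q(R)₂₄₂₄ - 2 Q(R)₁₂₃₄` as a sum of squares plus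
cross terms, valid for any algebraic curvature tensor and any orthonormal basis. -/
theorem stmt_17 {n : ℕ} (hn : 4 ≤ n) (R : CurvMap n) (hR : IsCurvatureTensor R)
    (b : OrthonormalBasis (Fin n) ℝ (Euc n)) :
    let i₁ : Fin n := ⟨0, by omega⟩
    let i₂ : Fin n := ⟨1, by omega⟩
    let i₃ : Fin n := ⟨2, by omega⟩
    let i₄ : Fin n := ⟨3, by omega⟩
    let e₁ : Euc n := b i₁
    let e₂ : Euc n := b i₂
    let e₃ : Euc n := b i₃
    let e₄ : Euc n := b i₄
    Qc R b i₁ i₃ i₁ i₃ + Qc R b i₁ i₄ i₁ i₄ + Qc R b i₂ i₃ i₂ i₃ + Qc R b i₂ i₄ i₂ i₄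
      - 2 * Qc R b i₁ i₂ i₃ i₄
    = (∑ p : Fin n, ∑ q : Fin n, (R e₁ e₃ (b p) (b q) - R e₂ e₄ (b p) (b q)) ^ 2)
      + (∑ p : Fin n, ∑ q : Fin n, (R e₁ e₄ (b p) (b q) + R e₂ e₃ (b p) (b q)) ^ 2)
      + 2 * (∑ p : Fin n, ∑ q : Fin n,
          (R e₁ (b p) e₁ (b q) + R e₂ (b p) e₂ (b q)) *
            (R e₃ (b p) e₃ (b q) + R e₄ (b p) e₄ (b q)))
      - 2 * (∑ p : Fin n, ∑ q : Fin n, R e₁ e₂ (b p) (b q) * R e₃ e₄ (b p) (b q))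
      - 2 * (∑ p : Fin n, ∑ q : Fin n,
          (R e₁ (b p) e₃ (b q) + R e₂ (b p) e₄ (b q)) *
            (R e₃ (b p) e₁ (b q) + R e₄ (b p) e₂ (b q)))
      - 2 * (∑ p : Fin n, ∑ q : Fin n,
          (R e₁ (b p) e₄ (b q) - R e₂ (b p) e₃ (b q)) *
            (R e₄ (b p) e₁ (b q) - R e₃ (b p) e₂ (b q))) := by
  intro i₁ i₂ i₃ i₄
  dsimp only
  have h₁ := hR.sum_mul_eq b (b i₁) (b i₃) (b i₂) (b i₄)
  have h₂ := hR.sum_mul_eq b (b i₁) (b i₄) (b i₂) (b i₃)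
  have h₃ := hR.sum_mul_swap b (b i₁) (b i₃) (b i₄) (b i₂)
  have h₄ := hR.sum_mul_swap b (b i₁) (b i₄) (b i₃) (b i₂)
  have comm (f g : Fin n → Fin n → ℝ) :
      ∑ p, ∑ q, f p q * g p q = ∑ p, ∑ q, g p q * f p q := by
    simp only [mul_comm]
  have c₁ := comm (fun p q => R (b i₁) (b i₃) (b p) (b q)) fun p q => R (b i₂) (b i₄) (b p) (b q)
  have c₂ := comm (fun p q => R (b i₁) (b i₄) (b p) (b q)) fun p q => R (b i₂) (b i₃) (b p) (b q)
  have c₃ := comm (fun p q => R (b i₃) (b p) (b i₁) (b q)) fun p q => R (b i₂) (b p) (b i₄) (b q)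
  have c₄ := comm (fun p q => R (b i₄) (b p) (b i₁) (b q)) fun p q => R (b i₂) (b p) (b i₃) (b q)
  simp only [Qc, sq, add_mul, sub_mul, mul_add, mul_sub, mul_assoc,
    Finset.sum_add_distrib, Finset.sum_sub_distrib, ← Finset.mul_sum]
  linarith
end
end

section
/- For any algebraic curvature tensor R on E and any orthonormal basis e_1,…,e_n, the first Bianchi identity implies Q(R)_{1234} = Σ_{p,q=1}^n R_{12pq} R_{34pq} + Σ_{p,q=1}^n R_{13pq} R_{24pq} - Σ_{p,q=1}^n R_{14pq} R_{23pq} + 2 Σ_{p,q=1}^n R_{1p3q} R_{4p2q} - 2 Σ_{p,q=1}^n R_{1p4q} R_{3p2q}. -/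
open scoped BigOperators
open RealInnerProductSpace

noncomputable section

/-- The first Bianchi identity, as a formula for the antisymmetrization in the first and third
arguments. -/
theorem IsCurvatureTensor.sub_swap {n : ℕ} {R : CurvMap n} (hR : IsCurvatureTensor R)
    (x y p q : Euc n) : R x p y q - R y p x q = R x y p q := by
  linarith [hR.2.2 x p y q, hR.1 p y x q, hR.1 y x p q]

/-- Swapping the first and third arguments of the second factor in a contraction of two curvature
terms produces a contraction over the last pair of arguments. -/
theorem IsCurvatureTensor.two_mul_sum_mul {n : ℕ} {ι : Type*} [Fintype ι] {R : CurvMap n}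
    (hR : IsCurvatureTensor R) (b : ι → Euc n) (x y z w : Euc n) :
    2 * ∑ p, ∑ q, R x (b p) z (b q) * R y (b p) w (b q)
      = ∑ p, ∑ q, R x z (b p) (b q) * R y w (b p) (b q)
        + 2 * ∑ p, ∑ q, R x (b p) z (b q) * R w (b p) y (b q) := by
  have hswap : ∑ p, ∑ q, R x (b p) z (b q) * R y w (b p) (b q)
      = -∑ p, ∑ q, R z (b p) x (b q) * R y w (b p) (b q) := by
    rw [Finset.sum_comm, ← Finset.sum_neg_distrib]
    refine Finset.sum_congr rfl fun p _ => ?_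
    rw [← Finset.sum_neg_distrib]
    refine Finset.sum_congr rfl fun q _ => ?_
    rw [hR.2.1 x (b q) z (b p), hR.2.1 y w (b q) (b p), hR.1 (b q) (b p) y w,
      hR.2.1 (b p) (b q) y w]
    ring
  have hy : ∑ p, ∑ q, R x (b p) z (b q) * R y w (b p) (b q)
      = ∑ p, ∑ q, R x (b p) z (b q) * R y (b p) w (b q)
        - ∑ p, ∑ q, R x (b p) z (b q) * R w (b p) y (b q) := by
    simp only [← hR.sub_swap y w, mul_sub, Finset.sum_sub_distrib]
  have hx : ∑ p, ∑ q, R x z (b p) (b q) * R y w (b p) (b q)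
      = ∑ p, ∑ q, R x (b p) z (b q) * R y w (b p) (b q)
        - ∑ p, ∑ q, R z (b p) x (b q) * R y w (b p) (b q) := by
    simp only [← hR.sub_swap x z, sub_mul, Finset.sum_sub_distrib]
  linarith

/-- The first Bianchi identity implies the following expression for `Q(R)₁₂₃₄`. -/
theorem stmt_18 {n : ℕ} (hn : 4 ≤ n) (R : CurvMap n) (hR : IsCurvatureTensor R)
    (b : OrthonormalBasis (Fin n) ℝ (Euc n)) :
    let i₁ : Fin n := ⟨0, by omega⟩
    let i₂ : Fin n := ⟨1, by omega⟩
    let i₃ : Fin n := ⟨2, by omega⟩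
    let i₄ : Fin n := ⟨3, by omega⟩
    let e₁ : Euc n := b i₁
    let e₂ : Euc n := b i₂
    let e₃ : Euc n := b i₃
    let e₄ : Euc n := b i₄
    Qc R b i₁ i₂ i₃ i₄
    = (∑ p : Fin n, ∑ q : Fin n, R e₁ e₂ (b p) (b q) * R e₃ e₄ (b p) (b q))
      + (∑ p : Fin n, ∑ q : Fin n, R e₁ e₃ (b p) (b q) * R e₂ e₄ (b p) (b q))
      - (∑ p : Fin n, ∑ q : Fin n, R e₁ e₄ (b p) (b q) * R e₂ e₃ (b p) (b q))
      + 2 * (∑ p : Fin n, ∑ q : Fin n, R e₁ (b p) e₃ (b q) * R e₄ (b p) e₂ (b q))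
      - 2 * (∑ p : Fin n, ∑ q : Fin n, R e₁ (b p) e₄ (b q) * R e₃ (b p) e₂ (b q)) := by
  intro i₁ i₂ i₃ i₄ e₁ e₂ e₃ e₄
  have h₁ := hR.two_mul_sum_mul b e₁ e₂ e₃ e₄
  have h₂ := hR.two_mul_sum_mul b e₁ e₂ e₄ e₃
  simp only [Qc, Finset.sum_add_distrib, Finset.sum_sub_distrib, mul_assoc, ← Finset.mul_sum]
  linarith
end
end
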